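/- arXiv:math/0208123 — 8 statements merged into one kernel-verified Lean document; each statement's English description precedes it below -/
import Mathlib

section
/- For every fixed integer m ≥ 0, as n → ∞ one has φ_{n,m} ∼ C_m · (27/2)^n · n^{-5/2}, i.e. the ratio φ_{n,m} / (C_m (27/2)^n n^{-5/2}) tends to 1. -/
open Filter

/-- `φ_{n,m}`: the number of rooted type II triangulations of a disc with `m+2`
boundary vertices and `n` internal vertices. -/
noncomputable def phi (n m : ℕ) : ℝ :=
  2 ^ (n + 1) * ((2 * m + 1).factorial : ℝ) * ((2 * m + 3 * n).factorial : ℝ) /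
    (((m.factorial : ℝ)) ^ 2 * ((n.factorial : ℝ)) * (((2 * m + 2 * n + 2).factorial : ℝ)))

/-- `C_m = (√3 (2m+1)! / (4 √π m!²)) (9/4)^m`. -/
noncomputable def Cconst (m : ℕ) : ℝ :=
  Real.sqrt 3 * ((2 * m + 1).factorial : ℝ) / (4 * Real.sqrt Real.pi * ((m.factorial : ℝ)) ^ 2)
    * (9 / 4) ^ m

lemma lin_ratio (a b c d : ℝ) (hc : 0 < c) :
    Tendsto (fun n : ℕ => (a * n + b) / (c * n + d)) atTop (nhds (a / c)) := by
  have h0 := tendsto_one_div_atTop_nhds_zero_nat (𝕜 := ℝ)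
  have h1 : Tendsto (fun n : ℕ => (a + b * (1 / (n : ℝ))) / (c + d * (1 / (n : ℝ)))) atTop
      (nhds ((a + b * 0) / (c + d * 0))) :=
    ((h0.const_mul b).const_add a).div ((h0.const_mul d).const_add c) (by simpa using hc.ne')
  simp only [mul_zero, add_zero] at h1
  refine h1.congr' ?_
  filter_upwards [eventually_gt_atTop 0] with n hn
  have hn' : (n : ℝ) ≠ 0 := by positivity
  rw [← mul_div_mul_right _ _ hn']
  congr 1 <;> field_simp

lemma fact_eq (n : ℕ) (hn : 0 < n) :
    (n.factorial : ℝ) = Stirling.stirlingSeq n * (Real.sqrt 2 * Real.sqrt n *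
      ((n : ℝ) ^ n / Real.exp n)) := by
  have hn' : (0 : ℝ) < n := by positivity
  have h : Real.exp n = Real.exp 1 ^ n := by rw [← Real.exp_nat_mul]; simp
  have h2 : 0 < Real.sqrt n := Real.sqrt_pos.2 hn'
  rw [Stirling.stirlingSeq, Real.sqrt_mul (by norm_num), div_pow, h]
  field_simp

lemma base_case :
    Tendsto (fun n : ℕ => phi n 0 / (Cconst 0 * (27 / 2) ^ n * (n : ℝ) ^ (-(5 : ℝ) / 2)))
      atTop (nhds 1) := by
  have hs := Stirling.tendsto_stirlingSeq_sqrt_pi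
  have hpi : 0 < Real.sqrt Real.pi := Real.sqrt_pos.2 Real.pi_pos
  have h2 : Tendsto (fun n : ℕ => 2 * n) atTop atTop :=
    tendsto_id.const_mul_atTop' (by norm_num)
  have h3 : Tendsto (fun n : ℕ => 3 * n) atTop atTop :=
    tendsto_id.const_mul_atTop' (by norm_num)
  have hA := (((hs.comp h3).mul_const (Real.sqrt Real.pi)).div (hs.mul (hs.comp h2))
    (by positivity)).mul ((lin_ratio 2 0 2 1 (by norm_num)).mul (lin_ratio 2 0 2 2 (by norm_num)))
  rw [div_self (by positivity), div_self (by norm_num), mul_one, mul_one] at hA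
  refine hA.congr' ?_
  filter_upwards [eventually_gt_atTop 0] with n hn
  have hn' : (0 : ℝ) < n := by positivity
  have hr : (n : ℝ) ^ (-(5 : ℝ) / 2) = 1 / (n ^ 2 * Real.sqrt n) := by
    rw [neg_div, Real.rpow_neg hn'.le, show (5 : ℝ) / 2 = (2 : ℕ) + 1 / 2 by norm_num,
      Real.rpow_add hn', Real.rpow_natCast, Real.sqrt_eq_rpow, one_div, one_div]
  have hf : ((2 * n + 2).factorial : ℝ) = (2 * n + 2) * ((2 * n + 1) * (2 * n).factorial) := by
    rw [Nat.factorial_succ, Nat.factorial_succ]; push_cast; ring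
  have hsp : ∀ k : ℕ, 0 < k → 0 < Stirling.stirlingSeq k := by
    intro k hk
    obtain ⟨j, rfl⟩ := Nat.exists_eq_succ_of_ne_zero hk.ne'
    exact Stirling.stirlingSeq'_pos j
  have e1 := hsp n hn
  have e2 := hsp (2 * n) (by omega)
  have e3 := hsp (3 * n) (by omega)
  have hsn : 0 < Real.sqrt n := Real.sqrt_pos.2 hn'
  have q2 : 0 < Real.sqrt 2 := by positivity
  have q3 : 0 < Real.sqrt 3 := by positivity
  have q22 : Real.sqrt 2 ^ 2 = 2 := Real.sq_sqrt (by norm_num)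
  have x2 : Real.exp (2 * n) = Real.exp n ^ 2 := by rw [← Real.exp_nat_mul]; simp
  have x3 : Real.exp (3 * n) = Real.exp n ^ 3 := by rw [← Real.exp_nat_mul]; simp
  have p2 : ((2 : ℝ) * n) ^ (2 * n) = 4 ^ n * ((n : ℝ) ^ n) ^ 2 := by
    rw [mul_pow, pow_mul, ← pow_mul (n : ℝ) n, mul_comm n 2]; norm_num
  have p3 : ((3 : ℝ) * n) ^ (3 * n) = 27 ^ n * ((n : ℝ) ^ n) ^ 3 := by
    rw [mul_pow, pow_mul, ← pow_mul (n : ℝ) n, mul_comm n 3]; norm_num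
  have p4 : (4 : ℝ) ^ n = (2 ^ n) ^ 2 := by rw [← pow_mul, mul_comm, pow_mul]; norm_num
  simp only [phi, Cconst, hr, Function.comp, Pi.div_apply]
  simp only [mul_zero, zero_add, Nat.factorial_zero, Nat.factorial_one, Nat.cast_one, pow_zero]
  rw [hf, fact_eq n hn, fact_eq (2 * n) (by omega), fact_eq (3 * n) (by omega)]
  push_cast
  rw [x2, x3, p2, p3, p4, Real.sqrt_mul (by norm_num), Real.sqrt_mul (by norm_num), div_pow, pow_succ]
  have hE := Real.exp_pos n
  generalize Real.exp (n : ℝ) = E at *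
  have hP : (0 : ℝ) < (n : ℝ) ^ n := by positivity
  generalize (n : ℝ) ^ n = P at *
  field_simp
  rw [q22]
  ring

/-- For fixed `m`, `φ_{n,m} ∼ C_m (27/2)^n n^{-5/2}` as `n → ∞`. -/
theorem phi_asymptotic (m : ℕ) :
    Tendsto (fun n : ℕ => phi n m / (Cconst m * (27 / 2) ^ n * (n : ℝ) ^ (-(5 : ℝ) / 2)))
      atTop (nhds 1) := by
  induction m with
  | zero => exact base_case
  | succ m ih =>
    have hA := ih.mul ((((lin_ratio 3 (2 * m + 1) 2 (2 * m + 3) (by norm_num))).mul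
      (lin_ratio 3 (2 * m + 2) 2 (2 * m + 4) (by norm_num))).const_mul (4 / 9))
    rw [show (1 : ℝ) * (4 / 9 * (3 / 2 * (3 / 2))) = 1 by norm_num] at hA
    refine hA.congr' ?_
    filter_upwards [eventually_gt_atTop 0] with n hn
    have hn' : (0 : ℝ) < n := by positivity
    have hr : (0 : ℝ) < (n : ℝ) ^ (-(5 : ℝ) / 2) := by positivity
    have f1 : ((2 * (m + 1) + 1).factorial : ℝ) =
        (2 * m + 3) * ((2 * m + 2) * (2 * m + 1).factorial) := by
      rw [show 2 * (m + 1) + 1 = 2 * m + 1 + 1 + 1 by ring, Nat.factorial_succ,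
        Nat.factorial_succ (2 * m + 1)]
      push_cast; ring
    have f2 : ((2 * (m + 1) + 3 * n).factorial : ℝ) =
        (3 * n + (2 * m + 2)) * ((3 * n + (2 * m + 1)) * (2 * m + 3 * n).factorial) := by
      rw [show 2 * (m + 1) + 3 * n = 2 * m + 3 * n + 1 + 1 by ring, Nat.factorial_succ,
        Nat.factorial_succ (2 * m + 3 * n)]
      push_cast; ring
    have f3 : ((2 * (m + 1) + 2 * n + 2).factorial : ℝ) =
        (2 * n + (2 * m + 4)) * ((2 * n + (2 * m + 3)) * (2 * m + 2 * n + 2).factorial) := by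
      rw [show 2 * (m + 1) + 2 * n + 2 = 2 * m + 2 * n + 2 + 1 + 1 by ring, Nat.factorial_succ,
        Nat.factorial_succ (2 * m + 2 * n + 2)]
      push_cast; ring
    have f4 : ((m + 1).factorial : ℝ) = (m + 1) * m.factorial := by
      rw [Nat.factorial_succ]; push_cast; ring
    simp only [phi, Cconst, f1, f2, f3, f4]
    generalize (n : ℝ) ^ (-(5 : ℝ) / 2) = r at *
    have g1 : (0 : ℝ) < (2 * m + 1).factorial := by positivity
    have g2 : (0 : ℝ) < (2 * m + 3 * n).factorial := by positivity
    have g3 : (0 : ℝ) < (2 * m + 2 * n + 2).factorial := by positivity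
    have g4 : (0 : ℝ) < m.factorial := by positivity
    have g5 : (0 : ℝ) < n.factorial := by positivity
    generalize ((2 * m + 1).factorial : ℝ) = F1 at *
    generalize ((2 * m + 3 * n).factorial : ℝ) = F2 at *
    generalize ((2 * m + 2 * n + 2).factorial : ℝ) = F3 at *
    generalize (m.factorial : ℝ) = F4 at *
    generalize (n.factorial : ℝ) = F5 at *
    rw [pow_succ (9 / 4 : ℝ) m]
    have g6 : (0 : ℝ) < (9 / 4) ^ m := by positivity
    generalize ((9 : ℝ) / 4) ^ m = F6 at *
    have hpi : 0 < Real.sqrt Real.pi := Real.sqrt_pos.2 Real.pi_pos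
    field_simp
    try ring
end

section
/- Let m ≥ 0 and let θ ∈ [0, 1/6], and set t = θ(1−2θ)². Then the series Σ_{n=0}^∞ φ_{n,m} t^n converges and equals ((2m)! ((1−6θ) m + 2 − 6θ) / (m! (m+2)!)) · (1−2θ)^{−(2m+2)}. -/
/-- Coefficients of the generalized binomial series `B_3(s)^a`. -/
noncomputable def bcoef (a : ℕ) : ℕ → ℝ
  | 0 => 1
  | n + 1 => a * ((a + 3 * n + 2).factorial : ℝ) /
      (((n + 1).factorial : ℝ) * ((a + 2 * n + 2).factorial : ℝ))

lemma bcoef_succ (a n : ℕ) : bcoef (a + 1) n =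
    (a + 1) * ((a + 3 * n).factorial : ℝ) /
      ((n.factorial : ℝ) * ((a + 2 * n + 1).factorial : ℝ)) := by
  cases n with
  | zero =>
    simp only [bcoef, Nat.mul_zero, Nat.add_zero, Nat.factorial_zero, Nat.factorial_succ]
    have : (a.factorial : ℝ) ≠ 0 := by positivity
    push_cast
    field_simp
  | succ n =>
    simp only [bcoef]
    rw [show a + 1 + 3 * n + 2 = a + 3 * (n + 1) by ring,
      show a + 1 + 2 * n + 2 = a + 2 * (n + 1) + 1 by ring]
    push_cast
    rfl

lemma bcoef_nonneg (a n : ℕ) : 0 ≤ bcoef a n := by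
  cases n <;> simp only [bcoef] <;> positivity

lemma bcoef_rec (a n : ℕ) :
    bcoef (a + 1) (n + 1) = bcoef a (n + 1) + bcoef (a + 3) n := by
  rw [bcoef_succ a (n + 1), bcoef_succ (a + 2) n]
  simp only [bcoef]
  rw [show a + 3 * (n + 1) = (a + 3 * n + 2) + 1 by ring,
    show a + 2 * (n + 1) + 1 = (a + 2 * n + 2) + 1 by ring,
    show a + 2 + 3 * n = a + 3 * n + 2 by ring,
    show a + 2 + 2 * n + 1 = (a + 2 * n + 2) + 1 by ring,
    Nat.factorial_succ (a + 3 * n + 2), Nat.factorial_succ (a + 2 * n + 2),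
    Nat.factorial_succ n]
  have h1 : (n.factorial : ℝ) ≠ 0 := by positivity
  have h2 : ((a + 2 * n + 2).factorial : ℝ) ≠ 0 := by positivity
  have h3 : ((a : ℝ) + 2 * n + 2 + 1) ≠ 0 := by positivity
  have h4 : ((n : ℝ) + 1) ≠ 0 := by positivity
  push_cast
  field_simp
  ring

/-- The first-passage weights. -/
noncomputable def bterm (x : ℝ) (a n : ℕ) : ℝ := bcoef a n * x ^ n * (1 - x) ^ (2 * n + a)

lemma bterm_rec (x : ℝ) (a n : ℕ) :
    bterm x (a + 1) (n + 1) = (1 - x) * bterm x a (n + 1) + x * bterm x (a + 3) n := by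
  simp only [bterm, bcoef_rec]
  ring

lemma bterm_rec0 (x : ℝ) (a : ℕ) : bterm x (a + 1) 0 = (1 - x) * bterm x a 0 := by
  simp only [bterm, bcoef]
  ring

lemma bterm_nonneg {x : ℝ} (h0 : 0 ≤ x) (h1 : x ≤ 1 / 3) (a n : ℕ) : 0 ≤ bterm x a n := by
  have : 0 ≤ 1 - x := by linarith
  have := bcoef_nonneg a n
  unfold bterm
  positivity

lemma bterm_zero (x : ℝ) (n : ℕ) : bterm x 0 n = if n = 0 then 1 else 0 := by
  cases n <;> simp [bterm, bcoef]

lemma bsum_le {x : ℝ} (h0 : 0 ≤ x) (h1 : x ≤ 1 / 3) (N : ℕ) :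
    ∀ a, ∑ n ∈ Finset.range N, bterm x a n ≤ 1 := by
  induction N with
  | zero => simp
  | succ N ihN =>
    intro a
    induction a with
    | zero => simp [bterm_zero]
    | succ a iha =>
      rw [Finset.sum_range_succ'] at iha ⊢
      simp only [bterm_rec, bterm_rec0, Finset.sum_add_distrib, ← Finset.mul_sum]
      have h2 := ihN (a + 3)
      have hq : 0 ≤ 1 - x := by linarith
      nlinarith [mul_le_mul_of_nonneg_left iha hq, mul_le_mul_of_nonneg_left h2 h0]

lemma bterm_summable {x : ℝ} (h0 : 0 ≤ x) (h1 : x ≤ 1 / 3) (a : ℕ) :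
    Summable (bterm x a) :=
  summable_of_sum_range_le (bterm_nonneg h0 h1 a) (fun N => bsum_le h0 h1 N a)

/-- A nonnegative bounded function, harmonic for the walk and vanishing at `0`, is zero. -/
lemma walk_harmonic_zero {x : ℝ} (h0 : 0 ≤ x) (h1 : x ≤ 1 / 3) (L : ℕ → ℝ)
    (hL0 : L 0 = 0) (hn : ∀ a, 0 ≤ L a) (hb : ∀ a, L a ≤ 1)
    (hr : ∀ a, L (a + 1) = (1 - x) * L a + x * L (a + 3)) (a : ℕ) : L a = 0 := by
  rcases h0.eq_or_lt with rfl | hx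
  · induction a with
    | zero => exact hL0
    | succ a ih => rw [hr, ih]; ring
  have hc : ∀ A, x * (L (A + 1) + L (A + 2)) - (1 - x) * L A = x * (L 1 + L 2) := by
    intro A
    induction A with
    | zero => simp [hL0]
    | succ A ih =>
      have := hr A
      rw [← ih, show A + 1 + 1 = A + 2 by ring, show A + 1 + 2 = A + 3 by ring]
      linarith
  have hg : ∀ A : ℕ, x * (L 1 + L 2) * A ≤ x * (L (A + 1) + 2 * L A) := by
    intro A
    induction A with
    | zero => simp [hL0]; exact mul_nonneg h0 (hn 1)
    | succ A ih =>
      have h2 := hc A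
      rw [show A + 1 + 1 = A + 2 by ring]
      push_cast
      nlinarith [mul_nonneg (show 0 ≤ 1 - 3 * x by linarith) (hn A)]
  have hc0 : x * (L 1 + L 2) = 0 := by
    by_contra hne
    have hpos : 0 < x * (L 1 + L 2) :=
      lt_of_le_of_ne (mul_nonneg h0 (add_nonneg (hn 1) (hn 2))) (Ne.symm hne)
    obtain ⟨A, hA⟩ := exists_nat_gt (1 / (x * (L 1 + L 2)))
    rw [div_lt_iff₀ hpos] at hA
    have h2 := hg A
    nlinarith [hb A, hb (A + 1), hn A, hn (A + 1)]
  have h12 : L 1 + L 2 = 0 := by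
    rcases mul_eq_zero.mp hc0 with h | h
    · exact absurd h hx.ne'
    · exact h
  have key : ∀ A, L A = 0 ∧ L (A + 1) = 0 := by
    intro A
    induction A with
    | zero => exact ⟨hL0, by have := hn 1; have := hn 2; simp; linarith⟩
    | succ A ih =>
      refine ⟨ih.2, ?_⟩
      have h2 := hc A
      rw [hc0, ih.1, ih.2] at h2
      have h3 : x * L (A + 2) = 0 := by linarith
      rcases mul_eq_zero.mp h3 with h | h
      · exact absurd h hx.ne'
      · exact h
  exact (key a).1

lemma bterm_hasSum {x : ℝ} (h0 : 0 ≤ x) (h1 : x ≤ 1 / 3) (a : ℕ) :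
    HasSum (bterm x a) 1 := by
  have hs := bterm_summable h0 h1
  have h := walk_harmonic_zero h0 h1 (fun a => 1 - ∑' n, bterm x a n) (by simp [bterm_zero])
    (fun a => sub_nonneg.mpr
      (Real.tsum_le_of_sum_range_le (bterm_nonneg h0 h1 a) (fun N => bsum_le h0 h1 N a)))
    (fun a => by
      have : 0 ≤ ∑' n, bterm x a n := tsum_nonneg (bterm_nonneg h0 h1 a)
      simpa using this)
    (fun a => by
      have e1 := (hs (a + 1)).tsum_eq_zero_add
      have e2 := (hs a).tsum_eq_zero_add
      have e3 : ∑' n, bterm x (a + 1) (n + 1) =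
          (1 - x) * ∑' n, bterm x a (n + 1) + x * ∑' n, bterm x (a + 3) n := by
        simp only [bterm_rec]
        rw [Summable.tsum_add _ ((hs (a + 3)).mul_left x), tsum_mul_left, tsum_mul_left]
        exact ((summable_nat_add_iff 1).mpr (hs a)).mul_left _
      rw [e1, e2, e3, bterm_rec0]
      ring) a
  have h2 : ∑' n, bterm x a n = 1 := by linarith
  rw [← h2]
  exact (hs a).hasSum

lemma hasSum_congr_fun_val {f g : ℕ → ℝ} {a b : ℝ} (h : f = g) (hab : a = b)
    (hs : HasSum g b) : HasSum f a := by
  rw [h, hab]; exact hs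

lemma phi_eq (n m : ℕ) : phi n m =
    2 ^ n * (((2 * m).factorial : ℝ) / ((m.factorial : ℝ) * ((m + 2).factorial : ℝ))) *
      (3 * (m + 1) * bcoef (2 * m + 1) n - (2 * m + 1) * bcoef (2 * m + 1 + 1) n) := by
  rw [bcoef_succ, bcoef_succ, phi]
  rw [show 2 * m + 2 * n + 2 = (2 * m + 2 * n + 1) + 1 by ring,
    show 2 * m + 1 + 3 * n = (2 * m + 3 * n) + 1 by ring,
    show 2 * m + 1 + 2 * n + 1 = (2 * m + 2 * n + 1) + 1 by ring,
    Nat.factorial_succ (2 * m + 2 * n + 1), Nat.factorial_succ (2 * m + 3 * n),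
    Nat.factorial_succ (2 * m), Nat.factorial_succ (m + 1), Nat.factorial_succ m]
  have h1 : (n.factorial : ℝ) ≠ 0 := by positivity
  have h2 : (m.factorial : ℝ) ≠ 0 := by positivity
  have h3 : ((2 * m + 2 * n + 1).factorial : ℝ) ≠ 0 := by positivity
  have h4 : ((2 : ℝ) * m + 2 * n + 1 + 1) ≠ 0 := by positivity
  have h5 : ((m : ℝ) + 1) ≠ 0 := by positivity
  have h6 : ((m : ℝ) + 1 + 1) ≠ 0 := by positivity
  push_cast
  field_simp
  ring

/-- For `θ ∈ [0, 1/6]` and `t = θ(1-2θ)²`, the partition function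
`Z_m(t) = Σ_n φ_{n,m} t^n` converges and equals
`((2m)! ((1-6θ)m + 2 - 6θ) / (m!(m+2)!)) (1-2θ)^{-(2m+2)}`. -/
theorem Z_formula (m : ℕ) (θ : ℝ) (hθ0 : 0 ≤ θ) (hθ1 : θ ≤ 1 / 6) :
    HasSum (fun n : ℕ => phi n m * (θ * (1 - 2 * θ) ^ 2) ^ n)
      ((((2 * m).factorial : ℝ) * ((1 - 6 * θ) * m + 2 - 6 * θ) /
          ((m.factorial : ℝ) * ((m + 2).factorial : ℝ))) *
        ((1 - 2 * θ) ^ (2 * m + 2))⁻¹) := by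
  have hx0 : 0 ≤ 2 * θ := by linarith
  have hx1 : 2 * θ ≤ 1 / 3 := by linarith
  have hq : 1 - 2 * θ ≠ 0 := by intro h; linarith
  have s1 := (bterm_hasSum hx0 hx1 (2 * m + 1)).mul_left (3 * ((m : ℝ) + 1) * (1 - 2 * θ))
  have s2 := (bterm_hasSum hx0 hx1 (2 * m + 1 + 1)).mul_left (2 * (m : ℝ) + 1)
  have s3 := (s1.sub s2).mul_left
    ((((2 * m).factorial : ℝ) / ((m.factorial : ℝ) * ((m + 2).factorial : ℝ))) *
        ((1 - 2 * θ) ^ (2 * m + 2))⁻¹)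
  refine (hasSum_congr_fun_val ?_ ?_ s3)
  · funext n
    rw [phi_eq]
    simp only [bterm]
    generalize bcoef (2 * m + 1) n = u
    generalize bcoef (2 * m + 1 + 1) n = v
    generalize ((2 * m).factorial : ℝ) / ((m.factorial : ℝ) * ((m + 2).factorial : ℝ)) = K
    rw [mul_pow, mul_pow, ← pow_mul, show 2 * n + (2 * m + 1 + 1) = 2 * n + (2 * m + 2) by ring,
      pow_add (1 - 2 * θ) (2 * n) (2 * m + 2), show (1 - 2 * θ) ^ (2 * n + (2 * m + 1)) =
      (1 - 2 * θ) ^ (2 * n) * (1 - 2 * θ) ^ (2 * m + 1) from pow_add _ _ _]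
    have e : (1 - 2 * θ) ^ (2 * m + 2) = (1 - 2 * θ) ^ (2 * m + 1) * (1 - 2 * θ) := pow_succ _ _
    rw [e]
    have : (1 - 2 * θ) ^ (2 * m + 1) ≠ 0 := pow_ne_zero _ hq
    generalize (1 - 2 * θ) ^ (2 * m + 1) = Q at *
    generalize (1 - 2 * θ) ^ (2 * n) = R at *
    generalize 1 - 2 * θ = q at *
    field_simp
  · ring
end

section
/- For every integer m ≥ 0, one has p_{−1,m} + Σ_{k=1}^{m} p_{k,m} = 1; that is, (2m+3)/(3m+3) + Σ_{k=1}^{m} 2 (2k−2)! m!² (2m−2k+1)! / ((k−1)! (k+1)! (m−k)!² (2m+1)!) = 1. -/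
/-- `p_{-1,m} = (2m+3)/(3m+3)`, the probability that the peeling step from boundary
size `m` adds a new vertex. -/
noncomputable def pMinusOne (m : ℕ) : ℝ := (2 * (m : ℝ) + 3) / (3 * (m : ℝ) + 3)

/-- `p_{k,m} = 2 (2k-2)! m!² (2m-2k+1)! / ((k-1)!(k+1)!(m-k)!²(2m+1)!)`, the probability
that the peeling step from boundary size `m` swallows `k` boundary vertices (`1 ≤ k ≤ m`). -/
noncomputable def pStep (k m : ℕ) : ℝ :=
  2 * ((2 * k - 2).factorial : ℝ) * ((m.factorial : ℝ)) ^ 2 *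
      ((2 * m - 2 * k + 1).factorial : ℝ) /
    (((k - 1).factorial : ℝ) * ((k + 1).factorial : ℝ) * (((m - k).factorial : ℝ)) ^ 2 *
      ((2 * m + 1).factorial : ℝ))

/-- Ratio of consecutive step probabilities. -/
lemma pStep_succ (k d : ℕ) :
    (2 * (d : ℝ) + 3) * (k + 3) * pStep (k + 2) (k + 2 + d) =
      (2 * k + 1) * (d + 1) * pStep (k + 1) (k + 2 + d) := by
  unfold pStep
  rw [show 2 * (k + 2) - 2 = 2 * k + 1 + 1 by omega,
    show 2 * (k + 2 + d) - 2 * (k + 2) + 1 = 2 * d + 1 by omega,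
    show k + 2 - 1 = k + 1 by omega, show k + 2 + d - (k + 2) = d by omega,
    show 2 * (k + 1) - 2 = 2 * k by omega,
    show 2 * (k + 2 + d) - 2 * (k + 1) + 1 = 2 * d + 1 + 1 + 1 by omega,
    show k + 1 - 1 = k by omega, show k + 2 + d - (k + 1) = d + 1 by omega,
    show k + 2 + 1 = k + 1 + 1 + 1 by omega]
  have h1 := Nat.factorial_ne_zero k
  have h2 := Nat.factorial_ne_zero d
  have h3 := Nat.factorial_ne_zero (2 * (k + 2 + d) + 1)
  generalize (2 * (k + 2 + d) + 1).factorial = A at *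
  generalize (k + 2 + d).factorial = B at *
  simp only [Nat.factorial_succ]
  generalize (2 * k).factorial = C at *
  generalize (2 * d).factorial = D at *
  push_cast
  have h1' : (k.factorial : ℝ) ≠ 0 := by exact_mod_cast h1
  have h2' : (d.factorial : ℝ) ≠ 0 := by exact_mod_cast h2
  have h3' : (A : ℝ) ≠ 0 := by exact_mod_cast h3
  field_simp
  ring

lemma pStep_one (d : ℕ) : pStep 1 (d + 1) = (d + 1) / (2 * (2 * d + 3)) := by
  unfold pStep
  rw [show 2 * (d + 1) - 2 * 1 + 1 = 2 * d + 1 by omega,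
    show d + 1 - 1 = d by omega, show 2 * (d + 1) + 1 = 2 * d + 1 + 1 + 1 by omega]
  have h2' : (d.factorial : ℝ) ≠ 0 := by exact_mod_cast Nat.factorial_ne_zero d
  have h3' : ((2 * d + 1).factorial : ℝ) ≠ 0 := by
    exact_mod_cast Nat.factorial_ne_zero (2 * d + 1)
  rw [Nat.factorial_succ (2 * d + 1 + 1), Nat.factorial_succ (2 * d + 1), Nat.factorial_succ d]
  norm_num
  field_simp
  ring

lemma partial_sum (k : ℕ) : ∀ d : ℕ,
    3 * ((k : ℝ) + d + 2) * ∑ i ∈ Finset.Icc 1 (k + 1), pStep i (k + 1 + d) =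
      (k + 1 + d) - (2 * k + 1) * d * pStep (k + 1) (k + 1 + d) := by
  induction k with
  | zero =>
    intro d
    have h := pStep_one d
    simp only [zero_add, Finset.Icc_self, Finset.sum_singleton, add_comm 1 d, h]
    push_cast
    field_simp
    ring
  | succ k ih =>
    intro d
    have h := ih (d + 1)
    have r := pStep_succ k d
    rw [Finset.sum_Icc_succ_top (by omega)]
    rw [show k + 1 + (d + 1) = k + 2 + d by omega] at h
    rw [show k + 1 + 1 + d = k + 2 + d by omega, show k + 1 + 1 = k + 2 by omega]
    push_cast at h ⊢
    linear_combination h + r / 1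

/-- The peeling step probabilities sum to one. -/
theorem step_probs_sum_to_one (m : ℕ) :
    pMinusOne m + ∑ k ∈ Finset.Icc 1 m, pStep k m = 1 := by
  rcases m with _ | k
  · simp [pMinusOne]
  · have h := partial_sum k 0
    simp only [add_zero, Nat.cast_zero, mul_zero, zero_mul, sub_zero] at h
    have hk : (k : ℝ) + 2 ≠ 0 := by positivity
    have hS : ∑ i ∈ Finset.Icc 1 (k + 1), pStep i (k + 1) = (k + 1) / (3 * (k + 2)) := by
      field_simp
      linear_combination h
    rw [hS, pMinusOne]
    push_cast
    have h3 : 3 * ((k : ℝ) + 1) + 3 = 3 * (k + 2) := by ring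
    rw [h3]
    field_simp
    ring
end

section
/- For all integers m ≥ 1 and 1 ≤ k ≤ m, one has p_{k,m} = p_k · (m)_k / (m+1/2)_k, where (x)_k = x(x−1)···(x−k+1) = Γ(x+1)/Γ(x−k+1) is the descending factorial; consequently for each fixed k ≥ 1 the sequence m ↦ p_{k,m} (defined for m ≥ k) is increasing in m and converges to p_k as m → ∞. -/
open Filter

/-- `p_k = 2 (2k-2)! / ((k-1)!(k+1)! 4^k)`, the limiting step probability. -/
noncomputable def pLim (k : ℕ) : ℝ :=
  2 * ((2 * k - 2).factorial : ℝ) / (((k - 1).factorial : ℝ) * ((k + 1).factorial : ℝ) * 4 ^ k)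

/-- The descending factorial `(x)_k = x(x-1)⋯(x-k+1) = Γ(x+1)/Γ(x-k+1)`. -/
noncomputable def descFact (x : ℝ) (k : ℕ) : ℝ := ∏ i ∈ Finset.range k, (x - i)

lemma descFact_succ_succ (x : ℝ) (k : ℕ) :
    descFact (x + 1) (k + 1) = (x + 1) * descFact x k := by
  unfold descFact
  rw [Finset.prod_range_succ', mul_comm]
  congr 1
  · simp
  · apply Finset.prod_congr rfl
    intro i _
    push_cast
    ring

lemma fact_eq_s7 (n k : ℕ) :
    ((n + k).factorial : ℝ) = n.factorial * descFact ((n + k : ℕ) : ℝ) k := by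
  induction k with
  | zero => simp [descFact]
  | succ k ih =>
    rw [← add_assoc, Nat.factorial_succ]
    have : ((n + k + 1 : ℕ) : ℝ) = ((n + k : ℕ) : ℝ) + 1 := by push_cast; ring
    rw [Nat.cast_mul, ih, this, descFact_succ_succ]
    ring

lemma fact_odd_eq (n k : ℕ) :
    ((2 * (n + k) + 1).factorial : ℝ) = (2 * n + 1).factorial * 4 ^ k *
      descFact ((n + k : ℕ) : ℝ) k * descFact (((n + k : ℕ) : ℝ) + 1 / 2) k := by
  induction k with
  | zero => simp [descFact]
  | succ k ih =>
    have h1 : 2 * (n + (k + 1)) + 1 = (2 * (n + k) + 1) + 1 + 1 := by ring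
    have h2 : ((n + (k + 1) : ℕ) : ℝ) = ((n + k : ℕ) : ℝ) + 1 := by push_cast; ring
    have h3 : ((n + k : ℕ) : ℝ) + 1 + 1 / 2 = (((n + k : ℕ) : ℝ) + 1 / 2) + 1 := by ring
    rw [h1, Nat.factorial_succ, Nat.factorial_succ, Nat.cast_mul, Nat.cast_mul, ih, h2, h3,
      descFact_succ_succ, descFact_succ_succ]
    push_cast
    ring

lemma descFact_pos (x : ℝ) (k : ℕ) (h : (k : ℝ) ≤ x) : 0 < descFact x k := by
  unfold descFact
  apply Finset.prod_pos
  intro i hi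
  have : (i : ℝ) < k := by exact_mod_cast Finset.mem_range.mp hi
  linarith

lemma pLim_pos (k : ℕ) : 0 < pLim k := by
  unfold pLim
  positivity

lemma pStep_eq (k m : ℕ) (h : k ≤ m) :
    pStep k m = pLim k * descFact (m : ℝ) k / descFact ((m : ℝ) + 1 / 2) k := by
  obtain ⟨n, rfl⟩ := Nat.exists_eq_add_of_le' h
  have hk : (k : ℝ) ≤ ((n + k : ℕ) : ℝ) := by exact_mod_cast h
  have h1 := (descFact_pos _ k hk).ne'
  have h2 := (descFact_pos (((n + k : ℕ) : ℝ) + 1 / 2) k (by linarith)).ne'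
  unfold pStep pLim
  have e1 : 2 * (n + k) - 2 * k + 1 = 2 * n + 1 := by omega
  have e2 : n + k - k = n := by omega
  rw [e1, e2, fact_odd_eq, fact_eq_s7]
  generalize descFact ((n + k : ℕ) : ℝ) k = a at *
  generalize descFact (((n + k : ℕ) : ℝ) + 1 / 2) k = b at *
  have p1 : ((2 * n + 1).factorial : ℝ) ≠ 0 := by positivity
  have p2 : (n.factorial : ℝ) ≠ 0 := by positivity
  have p3 : ((k - 1).factorial : ℝ) ≠ 0 := by positivity
  have p4 : ((k + 1).factorial : ℝ) ≠ 0 := by positivity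
  field_simp

lemma pStep_eq_prod (k m : ℕ) (h : k ≤ m) :
    pStep k m = pLim k * ∏ i ∈ Finset.range k, (((m : ℝ) - i) / ((m : ℝ) + 1 / 2 - i)) := by
  rw [pStep_eq k m h, Finset.prod_div_distrib, mul_div_assoc]
  rfl

/-- `p_{k,m} = p_k (m)_k / (m+1/2)_k`; consequently for fixed `k ≥ 1` the sequence
`m ↦ p_{k,m}` (for `m ≥ k`) is increasing in `m` and converges to `p_k`. -/
theorem pStep_ratio_monotone_tendsto (k : ℕ) (hk : 1 ≤ k) :
    (∀ m : ℕ, k ≤ m →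
      pStep k m = pLim k * descFact (m : ℝ) k / descFact ((m : ℝ) + 1 / 2) k) ∧
    (∀ m : ℕ, k ≤ m → pStep k m < pStep k (m + 1)) ∧
    Tendsto (fun m : ℕ => pStep k m) atTop (nhds (pLim k)) := by
  refine ⟨fun m h => pStep_eq k m h, fun m h => ?_, ?_⟩
  · rw [pStep_eq_prod k m h, pStep_eq_prod k (m + 1) (by omega)]
    apply mul_lt_mul_of_pos_left _ (pLim_pos k)
    apply Finset.prod_lt_prod_of_nonempty
    · intro i hi
      have : (i : ℝ) < m := by exact_mod_cast (Finset.mem_range.mp hi).trans_le h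
      apply div_pos <;> linarith
    · intro i hi
      have : (i : ℝ) < m := by exact_mod_cast (Finset.mem_range.mp hi).trans_le h
      push_cast
      rw [div_lt_div_iff₀ (by linarith) (by linarith)]
      nlinarith
    · exact ⟨0, Finset.mem_range.mpr hk⟩
  · have key : Tendsto (fun m : ℕ => pLim k *
        ∏ i ∈ Finset.range k, (((m : ℝ) - i) / ((m : ℝ) + 1 / 2 - i))) atTop
        (nhds (pLim k * ∏ i ∈ Finset.range k, (1 : ℝ))) := by
      apply Tendsto.const_mul
      apply tendsto_finsetProd
      intro i _
      have hT : Tendsto (fun m : ℕ => (m : ℝ) + (1 / 2 - i)) atTop atTop :=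
        tendsto_atTop_add_const_right _ _ tendsto_natCast_atTop_atTop
      have h0 : Tendsto (fun m : ℕ => 1 - (1 / 2 : ℝ) * ((m : ℝ) + (1 / 2 - i))⁻¹) atTop
          (nhds (1 - (1 / 2 : ℝ) * 0)) :=
        tendsto_const_nhds.sub (hT.inv_tendsto_atTop.const_mul _)
      rw [mul_zero, sub_zero] at h0
      refine h0.congr' ?_
      filter_upwards [hT.eventually_gt_atTop 0] with m hm
      rw [add_sub_assoc]
      have := hm.ne'
      rw [eq_div_iff this, sub_mul, mul_assoc, inv_mul_cancel₀ this]
      ring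
    simp only [Finset.prod_const_one, mul_one] at key
    refine key.congr' ?_
    filter_upwards [eventually_ge_atTop k] with m hm
    rw [pStep_eq_prod k m hm]
end

section
/- For every real x with 0 < x < 1/9, the series Σ_{k=1}^∞ k Z_{k−1} x^k converges and equals (2 − (2+9x) √(1−9x)) / (54 x). -/
/-- `Z_m = ((2m)!/(m!(m+2)!)) (9/4)^{m+1}`, the partition function of free
triangulations of an `(m+2)`-gon. -/
noncomputable def Zconst (m : ℕ) : ℝ :=
  ((2 * m).factorial : ℝ) / ((m.factorial : ℝ) * ((m + 2).factorial : ℝ)) * (9 / 4) ^ (m + 1)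

lemma catR (n : ℕ) : ((n : ℝ) + 1) * (catalan n : ℝ) = (n.centralBinom : ℝ) := by
  exact_mod_cast succ_mul_catalan_eq_centralBinom n

lemma cbR (n : ℕ) : ((n : ℝ) + 1) * ((n + 1).centralBinom : ℝ)
    = 2 * (2 * n + 1) * (n.centralBinom : ℝ) := by
  exact_mod_cast Nat.succ_mul_centralBinom_succ n

lemma catR_succ (n : ℕ) : ((n : ℝ) + 2) * (catalan (n + 1) : ℝ)
    = 2 * (2 * n + 1) * (catalan n : ℝ) := by
  have h1 := catR n
  have h2 := catR (n + 1)
  have h3 := cbR n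
  push_cast at h2
  have hn : ((n : ℝ) + 1) ≠ 0 := by positivity
  apply mul_left_cancel₀ hn
  linear_combination ((n : ℝ) + 1) * h2 + h3 - 2 * (2 * n + 1) * h1

lemma cat_partial (N : ℕ) : ∑ n ∈ Finset.range N, (catalan n : ℝ) * (1 / 4) ^ n
    = 2 - 2 * (N.centralBinom : ℝ) * (1 / 4) ^ N := by
  induction N with
  | zero => simp
  | succ N ih =>
    rw [Finset.sum_range_succ, ih]
    have h1 := catR N
    have h3 := cbR N
    have hn : ((N : ℝ) + 1) ≠ 0 := by positivity
    apply mul_left_cancel₀ hn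
    rw [pow_succ]
    linear_combination (1 / 4 : ℝ) ^ N * h1 + (1 / 2) * (1 / 4 : ℝ) ^ N * h3

lemma cat_partial_le (t : ℝ) (h0 : 0 ≤ t) (h1 : t ≤ 1 / 4) (N : ℕ) :
    ∑ n ∈ Finset.range N, (catalan n : ℝ) * t ^ n ≤ 2 := by
  calc _ ≤ ∑ n ∈ Finset.range N, (catalan n : ℝ) * (1 / 4) ^ n := by gcongr
    _ ≤ 2 := by
      rw [cat_partial]
      have : (0 : ℝ) ≤ 2 * (N.centralBinom : ℝ) * (1 / 4) ^ N := by positivity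
      linarith

lemma cat_hasSum (t : ℝ) (h0 : 0 < t) (h1 : t ≤ 1 / 4) :
    HasSum (fun n : ℕ => (catalan n : ℝ) * t ^ n) ((1 - Real.sqrt (1 - 4 * t)) / (2 * t)) := by
  have hnn : ∀ n : ℕ, 0 ≤ (catalan n : ℝ) * t ^ n := fun n => by positivity
  have hs : Summable (fun n : ℕ => (catalan n : ℝ) * t ^ n) :=
    summable_of_sum_range_le hnn (cat_partial_le t h0.le h1)
  have hle : ∑' n : ℕ, (catalan n : ℝ) * t ^ n ≤ 2 :=
    Real.tsum_le_of_sum_range_le hnn (cat_partial_le t h0.le h1)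
  have hsn : Summable (fun n : ℕ => ‖(catalan n : ℝ) * t ^ n‖) := hs.norm
  have hc := tsum_mul_tsum_eq_tsum_sum_antidiagonal_of_summable_norm hsn hsn
  have hz := hs.tsum_eq_zero_add
  have hterm : ∀ n : ℕ, (catalan (n + 1) : ℝ) * t ^ (n + 1) =
      t * ∑ kl ∈ Finset.HasAntidiagonal.antidiagonal n,
        ((catalan kl.1 : ℝ) * t ^ kl.1) * ((catalan kl.2 : ℝ) * t ^ kl.2) := by
    intro n
    rw [catalan_succ']
    push_cast
    rw [Finset.sum_mul, Finset.mul_sum]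
    apply Finset.sum_congr rfl
    intro kl hkl
    rw [← Finset.HasAntidiagonal.mem_antidiagonal.mp hkl]
    ring
  simp_rw [hterm] at hz
  rw [tsum_mul_left, ← hc] at hz
  have hS := hs.hasSum
  set S := ∑' n : ℕ, (catalan n : ℝ) * t ^ n with hSdef
  simp only [catalan_zero, Nat.cast_one, pow_zero, mul_one] at hz
  have hr : Real.sqrt (1 - 4 * t) = 1 - 2 * t * S := by
    have : 1 - 4 * t = (1 - 2 * t * S) ^ 2 := by linear_combination (4 * t) * hz
    rw [this, Real.sqrt_sq]
    nlinarith
  rw [hr]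
  convert hS using 1
  field_simp
  ring

lemma Zc (j : ℕ) (x : ℝ) : ((j : ℝ) + 1) * Zconst j * x ^ (j + 1) =
    (1 / 6) * ((catalan (j + 1) : ℝ) * (9 * x / 4) ^ (j + 1)
      + 2 * (9 * x / 4) * ((catalan j : ℝ) * (9 * x / 4) ^ j)) := by
  have h1 := catR j
  have h2 := catR_succ j
  have hf : (j.centralBinom : ℝ) * ((j.factorial : ℝ) * j.factorial) = ((2 * j).factorial : ℝ) := by
    have := Nat.choose_mul_factorial_mul_factorial (show j ≤ 2 * j by omega)
    rw [show 2 * j - j = j by omega] at this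
    rw [Nat.centralBinom, ← this]; push_cast; ring
  have h2' : (catalan (j + 1) : ℝ) = 2 * (2 * j + 1) * (catalan j : ℝ) / ((j : ℝ) + 2) := by
    rw [← h2]; field_simp
  have hj : (j.factorial : ℝ) ≠ 0 := by positivity
  rw [Zconst, ← hf, ← h1, h2', Nat.factorial_succ, Nat.factorial_succ,
    show 9 * x / 4 = 9 / 4 * x by ring, mul_pow, mul_pow]
  push_cast
  rw [show (j : ℝ) + 1 + 1 = j + 2 by ring]
  field_simp
  ring

/-- For `0 < x < 1/9`, `Σ_{k≥1} k Z_{k-1} x^k = (2 - (2+9x)√(1-9x)) / (54x)`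
(here the sum is indexed so that the `k`-th term, `k ≥ 1`, is written with `k = j+1`). -/
theorem Zconst_generating_function (x : ℝ) (hx0 : 0 < x) (hx1 : x < 1 / 9) :
    HasSum (fun j : ℕ => ((j : ℝ) + 1) * Zconst j * x ^ (j + 1))
      ((2 - (2 + 9 * x) * Real.sqrt (1 - 9 * x)) / (54 * x)) := by
  have h := cat_hasSum (9 * x / 4) (by linarith) (by linarith)
  have h' := (hasSum_nat_add_iff' 1).mpr h
  have hh := (h'.add (h.mul_left (2 * (9 * x / 4)))).mul_left (1 / 6)
  simp_rw [Zc]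
  have key : ∀ a b : ℝ, HasSum (fun i : ℕ => 1 / 6 * ((catalan (i + 1) : ℝ) * (9 * x / 4) ^ (i + 1) +
      2 * (9 * x / 4) * ((catalan i : ℝ) * (9 * x / 4) ^ i))) a → b = a →
      HasSum (fun i : ℕ => 1 / 6 * ((catalan (i + 1) : ℝ) * (9 * x / 4) ^ (i + 1) +
      2 * (9 * x / 4) * ((catalan i : ℝ) * (9 * x / 4) ^ i))) b := fun a b h e => e ▸ h
  refine key _ _ hh ?_
  rw [show 1 - 4 * (9 * x / 4) = 1 - 9 * x by ring]
  simp only [Finset.range_one, Finset.sum_singleton, catalan_zero, Nat.cast_one, pow_zero, mul_one]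
  field_simp
  ring
end

section
/- Fix an integer m ≥ 0 and define a : ℕ → ℝ by a(n) = 1 − (n)_{m+1} / (n+1/2)_{m+1}, where (x)_{m+1} = x(x−1)···(x−m) = Γ(x+1)/Γ(x−m) is the descending factorial (so a(n) = 1 for n ≤ m). Then for every integer n ≥ 0 with n ≠ m, a(n) = p_{−1,n} · a(n+1) + Σ_{k=1}^{n} p_{k,n} · a(n−k); that is, a is harmonic for the peeling transition probabilities away from m. -/
/-- The weight `w(n) = (2n+1)!/n!²`. -/
noncomputable def wgt (n : ℕ) : ℝ := ((2 * n + 1).factorial : ℝ) / (n.factorial : ℝ) ^ 2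

/-- Coefficients of `(1-4x)^{3/2}/6`. -/
noncomputable def fco : ℕ → ℝ
  | 0 => 1 / 6
  | 1 => -1
  | (k + 2) => 2 * ((2 * k).factorial : ℝ) / ((k.factorial : ℝ) * ((k + 2).factorial : ℝ))

lemma wgt_pos (n : ℕ) : 0 < wgt n := by
  unfold wgt; positivity

lemma wgt_succ (n : ℕ) : ((n : ℝ) + 1) * wgt (n + 1) = (4 * n + 6) * wgt n := by
  unfold wgt
  have h : (n.factorial : ℝ) ≠ 0 := by positivity
  have h1 : (n : ℝ) + 1 ≠ 0 := by positivity
  rw [show 2 * (n + 1) + 1 = (2 * n + 1) + 1 + 1 by ring, Nat.factorial_succ (2 * n + 1 + 1),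
    Nat.factorial_succ (2 * n + 1), Nat.factorial_succ n]
  push_cast
  field_simp
  ring

lemma fco_succ (i : ℕ) : ((i : ℝ) + 1) * fco (i + 1) = (4 * i - 6) * fco i := by
  match i with
  | 0 => norm_num [fco]
  | 1 => norm_num [fco]
  | (k + 2) =>
    simp only [fco]
    have h : (k.factorial : ℝ) ≠ 0 := by positivity
    have h1 : (k : ℝ) + 1 ≠ 0 := by positivity
    have h2 : (k : ℝ) + 2 ≠ 0 := by positivity
    have h3 : (k : ℝ) + 3 ≠ 0 := by positivity
    rw [show 2 * (k + 1) = (2 * k) + 1 + 1 by ring, Nat.factorial_succ (2 * k + 1),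
      Nat.factorial_succ (2 * k), Nat.factorial_succ (k + 1 + 1), Nat.factorial_succ (k + 1),
      Nat.factorial_succ k]
    push_cast
    rw [show (k : ℝ) + 1 + 1 + 1 = k + 3 by ring, show (k : ℝ) + 1 + 1 = k + 2 by ring,
      show (k : ℝ) + 2 + 1 = k + 3 by ring]
    field_simp
    ring

lemma conv_succ (N : ℕ) :
    ((N : ℝ) + 1) * ∑ p ∈ Finset.HasAntidiagonal.antidiagonal (N + 1), fco p.1 * wgt p.2
      = 4 * N * ∑ p ∈ Finset.HasAntidiagonal.antidiagonal N, fco p.1 * wgt p.2 := by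
  have e1 : ((N : ℝ) + 1) * ∑ p ∈ Finset.HasAntidiagonal.antidiagonal (N + 1), fco p.1 * wgt p.2
      = (∑ p ∈ Finset.HasAntidiagonal.antidiagonal (N + 1), (p.1 : ℝ) * fco p.1 * wgt p.2)
        + ∑ p ∈ Finset.HasAntidiagonal.antidiagonal (N + 1), (p.2 : ℝ) * fco p.1 * wgt p.2 := by
    rw [Finset.mul_sum, ← Finset.sum_add_distrib]
    refine Finset.sum_congr rfl fun p hp => ?_
    have h : (p.1 : ℝ) + p.2 = N + 1 := by exact_mod_cast Finset.HasAntidiagonal.mem_antidiagonal.1 hp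
    rw [← h]; ring
  rw [e1, Finset.Nat.sum_antidiagonal_succ, Finset.Nat.sum_antidiagonal_succ', Finset.mul_sum]
  simp only [Nat.cast_zero, zero_mul, zero_add, add_zero, Nat.cast_add, Nat.cast_one]
  rw [← Finset.sum_add_distrib]
  refine Finset.sum_congr rfl fun p hp => ?_
  have h : (p.1 : ℝ) + p.2 = N := by exact_mod_cast Finset.HasAntidiagonal.mem_antidiagonal.1 hp
  rw [← h]
  linear_combination wgt p.2 * fco_succ p.1 + fco p.1 * wgt_succ p.2

lemma conv_zero (N : ℕ) :
    ∑ i ∈ Finset.range (N + 2), fco i * wgt (N + 1 - i) = 0 := by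
  have key : ∑ p ∈ Finset.HasAntidiagonal.antidiagonal (N + 1), fco p.1 * wgt p.2 = 0 := by
    induction N with
    | zero =>
      have := conv_succ 0
      simpa using this
    | succ k ih =>
      have := conv_succ (k + 1)
      rw [ih, mul_zero] at this
      exact (mul_eq_zero.1 this).resolve_left (by positivity)
  rw [Finset.Nat.sum_antidiagonal_eq_sum_range_succ_mk] at key
  exact key

lemma descFact_succ (x : ℝ) (k : ℕ) : descFact x (k + 1) = x * descFact (x - 1) k := by
  unfold descFact
  rw [Finset.prod_range_succ', mul_comm]
  congr 1
  · simp
  · refine Finset.prod_congr rfl fun i _ => ?_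
    push_cast; ring

lemma wgt_desc (j k : ℕ) : wgt (j + k) * descFact ((j + k : ℕ) : ℝ) k
    = 4 ^ k * wgt j * descFact (((j + k : ℕ) : ℝ) + 1 / 2) k := by
  induction k with
  | zero => simp [descFact]
  | succ k ih =>
    have h := wgt_succ (j + k)
    rw [descFact_succ, descFact_succ, ← add_assoc j k 1]
    rw [show (((j + k + 1 : ℕ) : ℝ)) - 1 = ((j + k : ℕ) : ℝ) by push_cast; ring,
      show (((j + k + 1 : ℕ) : ℝ)) + 1 / 2 - 1 = ((j + k : ℕ) : ℝ) + 1 / 2 by push_cast; ring]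
    push_cast at *
    linear_combination descFact ((j : ℝ) + k) k * h + (4 * ((j : ℝ) + k) + 6) * ih

lemma ratio_zero (m j : ℕ) (h : j ≤ m) : descFact (j : ℝ) (m + 1) = 0 := by
  unfold descFact
  exact Finset.prod_eq_zero (Finset.mem_range.2 (Nat.lt_succ_of_le h)) (sub_self _)

lemma wgt_ratio (m j : ℕ) : wgt (j + (m + 1)) * (descFact ((j + (m + 1) : ℕ) : ℝ) (m + 1)
    / descFact (((j + (m + 1) : ℕ) : ℝ) + 1 / 2) (m + 1)) = 4 ^ (m + 1) * wgt j := by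
  have hne : descFact (((j + (m + 1) : ℕ) : ℝ) + 1 / 2) (m + 1) ≠ 0 := by
    unfold descFact
    refine (Finset.prod_pos fun i hi => ?_).ne'
    have : (i : ℝ) ≤ ((j + (m + 1) : ℕ) : ℝ) := by
      have := Finset.mem_range.1 hi
      exact_mod_cast (by omega : i ≤ j + (m + 1))
    linarith
  rw [← mul_div_assoc, wgt_desc, mul_div_assoc, div_self hne, mul_one]

lemma pMinusOne_eq (n : ℕ) : pMinusOne n * wgt n = fco 0 * wgt (n + 1) := by
  have h := wgt_succ n
  have h1 : (n : ℝ) + 1 ≠ 0 := by positivity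
  have h3 : 3 * (n : ℝ) + 3 ≠ 0 := by positivity
  simp only [pMinusOne, fco]
  field_simp
  linear_combination -3 * h

lemma pStep_eq_s11 (n k : ℕ) (hk : k + 1 ≤ n) :
    pStep (k + 1) n * wgt n = fco (k + 2) * wgt (n - (k + 1)) := by
  simp only [pStep, fco, wgt]
  rw [show 2 * (k + 1) - 2 = 2 * k by omega, show k + 1 - 1 = k by omega,
    show 2 * n - 2 * (k + 1) + 1 = 2 * (n - (k + 1)) + 1 by omega]
  have a1 : (n.factorial : ℝ) ≠ 0 := by positivity
  have a2 : ((2 * n + 1).factorial : ℝ) ≠ 0 := by positivity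
  have a3 : ((n - (k + 1)).factorial : ℝ) ≠ 0 := by positivity
  have a4 : (k.factorial : ℝ) ≠ 0 := by positivity
  have a5 : ((k + 2).factorial : ℝ) ≠ 0 := by positivity
  rw [show k + 1 + 1 = k + 2 from rfl]
  field_simp

lemma harm_iff (n : ℕ) (b : ℕ → ℝ)
    (h : ∑ i ∈ Finset.range (n + 2), fco i * (wgt (n + 1 - i) * b (n + 1 - i)) = 0) :
    b n = pMinusOne n * b (n + 1) + ∑ k ∈ Finset.Icc 1 n, pStep k n * b (n - k) := by
  rw [Finset.sum_range_succ', Finset.sum_range_succ'] at h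
  have hs : wgt n * ∑ k ∈ Finset.Icc 1 n, pStep k n * b (n - k)
      = ∑ k ∈ Finset.range n, fco (k + 1 + 1) *
        (wgt (n + 1 - (k + 1 + 1)) * b (n + 1 - (k + 1 + 1))) := by
    rw [Finset.mul_sum, Finset.range_eq_Ico,
      show Finset.Icc 1 n = Finset.Ico (0 + 1) (n + 1) by ext; simp [Nat.lt_succ_iff],
      ← Finset.sum_Ico_add' _ 0 n 1]
    refine Finset.sum_congr rfl fun k hk => ?_
    have hk := (Finset.mem_Ico.1 hk).2
    rw [show n + 1 - (k + 1 + 1) = n - (k + 1) by omega]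
    linear_combination b (n - (k + 1)) * pStep_eq_s11 n k hk
  rw [← hs] at h
  have h1 : fco (0 + 1) = -1 := rfl
  rw [h1] at h
  simp only [zero_add, Nat.add_sub_cancel, Nat.sub_zero] at h
  have hp := pMinusOne_eq n
  apply mul_left_cancel₀ (wgt_pos n).ne'
  linear_combination -h - b (n + 1) * hp

/-- The hitting-probability function `a(n) = 1 - (n)_{m+1}/(n+1/2)_{m+1}` is harmonic
for the peeling transition probabilities away from `m`:
for every `n ≠ m`, `a(n) = p_{-1,n} a(n+1) + Σ_{k=1}^n p_{k,n} a(n-k)`. -/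
theorem hitting_prob_harmonic (m : ℕ) (a : ℕ → ℝ)
    (ha : ∀ n : ℕ, a n = 1 - descFact (n : ℝ) (m + 1) / descFact ((n : ℝ) + 1 / 2) (m + 1)) :
    ∀ n : ℕ, n ≠ m →
      a n = pMinusOne n * a (n + 1) + ∑ k ∈ Finset.Icc 1 n, pStep k n * a (n - k) := by
  intro n hn
  apply harm_iff
  simp only [ha, mul_sub, mul_one]
  rw [Finset.sum_sub_distrib, conv_zero, zero_sub, neg_eq_zero]
  rcases lt_or_gt_of_ne hn with h | h
  · refine Finset.sum_eq_zero fun i _ => ?_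
    rw [ratio_zero m (n + 1 - i) (by omega)]
    simp
  · obtain ⟨d, rfl⟩ := Nat.exists_eq_add_of_lt h
    rw [← Finset.sum_subset (Finset.range_subset_range.2 (by omega : d + 2 ≤ m + d + 1 + 2))]
    · have hc := conv_zero d
      rw [← mul_zero ((4 : ℝ) ^ (m + 1)), ← hc, Finset.mul_sum]
      refine Finset.sum_congr rfl fun i hi => ?_
      have hi := Finset.mem_range.1 hi
      rw [show m + d + 1 + 1 - i = (d + 1 - i) + (m + 1) by omega, wgt_ratio]
      ring
    · intro i _ hi
      have hi : ¬ i < d + 2 := fun h => hi (Finset.mem_range.2 h)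
      rw [ratio_zero m (m + d + 1 + 1 - i) (by omega)]
      simp
end

section
/- Let (M_t)_{t≥0} be a peeling Markov chain started from any fixed state m₀ ∈ ℕ. Then almost surely limsup_{n→∞} M_n / (n^{2/3} log n) < ∞. -/
open Filter MeasureTheory ProbabilityTheory

/-- The one-step transition probability of the peeling Markov chain: from state `m`
the chain moves to `m+1` with probability `p_{-1,m}`, and to `m-k` with probability
`p_{k,m}` for `1 ≤ k ≤ m`. -/
noncomputable def peelTransition (m j : ℕ) : ℝ :=
  if j = m + 1 then pMinusOne m
  else if j < m then pStep (m - j) m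
  else 0

/-- `(M_t)_{t≥0}` is a peeling Markov chain w.r.t. the probability measure `P`:
each `M t` is measurable, and conditionally on any initial trajectory
`(M_0,…,M_t) = (h 0,…,h t)` of positive probability, `M_{t+1} = j` with
probability `peelTransition (h t) j`. -/
def IsPeelingChain {Ω : Type*} [MeasurableSpace Ω] (P : Measure Ω) (M : ℕ → Ω → ℕ) : Prop :=
  (∀ t, Measurable (M t)) ∧
  ∀ (t : ℕ) (h : ℕ → ℕ),
    P {ω | ∀ i ≤ t, M i ω = h i} ≠ 0 →
    ∀ j : ℕ,
      (P[|{ω | ∀ i ≤ t, M i ω = h i}]) {ω | M (t + 1) ω = j} =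
        ENNReal.ofReal (peelTransition (h t) j)


noncomputable def hh (m : ℕ) : ℝ :=
  ((2 * m + 1).factorial : ℝ) / ((m.factorial : ℝ) ^ 2 * 4 ^ m)

noncomputable def qq (k : ℕ) : ℝ :=
  2 * ((2 * k).factorial : ℝ) / ((k.factorial : ℝ) * ((k + 2).factorial : ℝ) * 4 ^ (k + 1))

lemma hh_pos (m : ℕ) : 0 < hh m := by unfold hh; positivity

lemma qq_pos (m : ℕ) : 0 < qq m := by unfold qq; positivity

lemma hh_zero : hh 0 = 1 := by simp [hh]

lemma hh_succ (m : ℕ) : hh (m + 1) = hh m * ((2 * m + 3) / (2 * m + 2)) := by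
  have e : 2 * (m + 1) + 1 = (2 * m + 1) + 1 + 1 := by ring
  have := m.factorial_pos
  unfold hh
  rw [e, Nat.factorial_succ (2 * m + 1 + 1), Nat.factorial_succ (2 * m + 1), Nat.factorial_succ m]
  push_cast
  field_simp
  ring

lemma hh_le (m : ℕ) : hh m ≤ 2 * m + 1 := by
  induction m with
  | zero => simp [hh_zero]
  | succ m ih =>
    rw [hh_succ]
    calc _ ≤ (2 * (m : ℝ) + 1) * ((2 * m + 3) / (2 * m + 2)) := by gcongr
      _ ≤ _ := by
        rw [← mul_div_assoc, div_le_iff₀ (by positivity)]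
        push_cast
        nlinarith [(Nat.cast_nonneg m : (0 : ℝ) ≤ m)]

lemma pMinusOne_eq_s12 (m : ℕ) : pMinusOne m = 2 / 3 * (hh (m + 1) / hh m) := by
  have := (hh_pos m).ne'
  rw [hh_succ, pMinusOne]
  field_simp

lemma pStep_eq_s12 (k d : ℕ) : pStep (k + 1) (d + (k + 1)) =
    qq k * (hh d / hh (d + (k + 1))) := by
  have e1 : 2 * (k + 1) - 2 = 2 * k := by omega
  have e2 : 2 * (d + (k + 1)) - 2 * (k + 1) + 1 = 2 * d + 1 := by omega
  have e3 : d + (k + 1) - (k + 1) = d := by omega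
  have e4 : k + 1 - 1 = k := by omega
  have e5 : k + 1 + 1 = k + 2 := by omega
  unfold pStep hh qq
  rw [e1, e2, e3, e4, e5]
  have := (2 * (d + (k + 1)) + 1).factorial_pos
  have := (d + (k + 1)).factorial_pos
  field_simp
  ring

lemma choose_rec (a : ℝ) (n : ℕ) :
    Ring.choose a (n + 1) * (n + 1) = Ring.choose a n * (a - n) := by
  rw [Ring.choose_eq_smul, Ring.choose_eq_smul, descPochhammer_succ_right,
    Polynomial.smeval_mul, Nat.factorial_succ]
  have : ((Polynomial.X - (n : Polynomial ℤ)).smeval a) = a - n := by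
    simp [Polynomial.smeval_sub, Polynomial.smeval_X, Polynomial.smeval_natCast]
  rw [this]
  have := n.factorial_pos
  simp only [smul_eq_mul]
  push_cast
  field_simp

lemma qq_eq (k : ℕ) : qq k = 2 / 3 * (Ring.choose (3 / 2 : ℝ) (k + 2) * (-1) ^ k) := by
  induction k with
  | zero =>
    have h1 := choose_rec (3 / 2) 1
    rw [Ring.choose_one_right] at h1
    norm_num at h1
    simp [qq, Nat.factorial]
    linarith
  | succ k ih =>
    have h1 := choose_rec (3 / 2) (k + 2)
    have h2 : Ring.choose (3 / 2 : ℝ) (k + 1 + 2) =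
        Ring.choose (3 / 2 : ℝ) (k + 2) * (3 / 2 - (k + 2)) / (k + 3) := by
      rw [eq_div_iff (by positivity)]
      push_cast at h1
      rw [← h1]; ring_nf
    have h3 : qq (k + 1) = qq k * ((2 * k + 1) / (2 * (k + 3))) := by
      unfold qq
      have e : 2 * (k + 1) = 2 * k + 1 + 1 := by ring
      have e' : k + 1 + 2 = k + 2 + 1 := by ring
      rw [e, e', Nat.factorial_succ (2 * k + 1), Nat.factorial_succ (2 * k),
        Nat.factorial_succ (k + 2), Nat.factorial_succ k]
      have := k.factorial_pos
      have := (k + 2).factorial_pos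
      push_cast
      field_simp
      ring
    rw [h3, ih, h2, pow_succ]
    field_simp
    ring

lemma hasSum_binom {y : ℝ} (h0 : 0 < y) (h1 : y < 1) :
    HasSum (fun n => Ring.choose (3 / 2 : ℝ) n * (-y) ^ n) ((1 - y) ^ (3 / 2 : ℝ)) := by
  have := (Real.one_add_rpow_hasFPowerSeriesOnBall_zero (a := 3 / 2)).hasSum (y := -y)
    (by simp [← ofReal_norm, abs_of_pos h0]; exact h1)
  simp only [binomialSeries_apply] at this
  have e : (1 - y) ^ (3 / 2 : ℝ) = (1 + (0 + -y)) ^ (3 / 2 : ℝ) := by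
    rw [zero_add, sub_eq_add_neg]
  rw [e]
  simpa using! this

lemma sum_qq_le {y : ℝ} (h0 : 0 < y) (h1 : y < 1) (m : ℕ) :
    ∑ k ∈ Finset.range m, qq k * y ^ (k + 1) ≤
      1 + 2 / 3 * ((1 - y) ^ (3 / 2 : ℝ) - 1) / y := by
  have h := (hasSum_nat_add_iff' 2).2 (hasSum_binom h0 h1)
  have h' := h.mul_left (2 / 3 / y)
  have e : (fun n : ℕ => 2 / 3 / y * (Ring.choose (3 / 2 : ℝ) (n + 2) * (-y) ^ (n + 2))) =
      fun k => qq k * y ^ (k + 1) := by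
    funext k
    rw [qq_eq, neg_pow]
    field_simp
    ring
  rw [e] at h'
  refine (sum_le_hasSum _ (fun k _ => mul_nonneg (qq_pos k).le (by positivity)) h').trans_eq ?_
  simp [Finset.sum_range_succ]
  field_simp
  ring

noncomputable def ff (y : ℝ) (m : ℕ) : ℝ := y⁻¹ ^ m / hh m

lemma drift {y : ℝ} (h0 : 0 < y) (h1 : y < 1) (m : ℕ) :
    ∑ j ∈ Finset.range (m + 2), peelTransition m j * ff y j ≤
      (1 + 2 / 3 * (1 - y) ^ (3 / 2 : ℝ) / y) * ff y m := by
  have hm := hh_pos m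
  rw [Finset.sum_range_succ, Finset.sum_range_succ]
  have e1 : peelTransition m m = 0 := by simp [peelTransition]
  have e2 : peelTransition m (m + 1) * ff y (m + 1) = 2 / 3 / y * ff y m := by
    have := hh_pos (m + 1)
    simp only [peelTransition, if_true, pMinusOne_eq_s12, ff, pow_succ]
    field_simp
  have e3 : ∑ j ∈ Finset.range m, peelTransition m j * ff y j =
      (∑ k ∈ Finset.range m, qq k * y ^ (k + 1)) * ff y m := by
    rw [← Finset.sum_range_reflect, Finset.sum_mul]
    refine Finset.sum_congr rfl fun k hk => ?_
    rw [Finset.mem_range] at hk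
    obtain ⟨d, rfl⟩ : ∃ d, m = d + (k + 1) := ⟨m - (k + 1), by omega⟩
    have e4 : d + (k + 1) - 1 - k = d := by omega
    have e5 : d + (k + 1) - d = k + 1 := by omega
    rw [e4, peelTransition, if_neg (by omega), if_pos (by omega), e5, pStep_eq_s12, ff, ff]
    have := hh_pos d
    rw [pow_add, inv_pow, inv_pow]
    field_simp
    ring
  rw [e1, e2, e3, zero_mul, add_zero, ← add_mul]
  have : 0 < ff y m := by unfold ff; positivity
  refine mul_le_mul_of_nonneg_right ?_ this.le
  have := sum_qq_le h0 h1 m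
  have e6 : 1 + 2 / 3 * (1 - y) ^ (3 / 2 : ℝ) / y =
    (1 + 2 / 3 * ((1 - y) ^ (3 / 2 : ℝ) - 1) / y) + 2 / 3 / y := by ring
  linarith

lemma peel_nonneg (m j : ℕ) : 0 ≤ peelTransition m j := by
  unfold peelTransition pMinusOne pStep
  split_ifs <;> positivity

lemma drift_enn {y : ℝ} (h0 : 0 < y) (h1 : y < 1) (m : ℕ) :
    ∑' j, ENNReal.ofReal (ff y j) * ENNReal.ofReal (peelTransition m j) ≤
      ENNReal.ofReal (1 + 2 / 3 * (1 - y) ^ (3 / 2 : ℝ) / y) * ENNReal.ofReal (ff y m) := by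
  have hf : ∀ j, 0 ≤ ff y j := fun j => by
    have := hh_pos j
    unfold ff; positivity
  rw [tsum_eq_sum (s := Finset.range (m + 2)), ← ENNReal.ofReal_mul' (hf m)]
  · simp_rw [← ENNReal.ofReal_mul (hf _)]
    rw [← ENNReal.ofReal_sum_of_nonneg fun j _ => mul_nonneg (hf j) (peel_nonneg m j)]
    refine ENNReal.ofReal_le_ofReal ?_
    simpa only [mul_comm] using drift h0 h1 m
  · intro j hj
    rw [Finset.mem_range] at hj
    simp [peelTransition, show j ≠ m + 1 by omega, show ¬ j < m by omega]

lemma step_bound {Ω : Type*} [MeasurableSpace Ω] (P : Measure Ω)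
    [IsProbabilityMeasure P] (M : ℕ → Ω → ℕ) (hM : IsPeelingChain P M)
    (f : ℕ → ENNReal) (K : ENNReal)
    (hf : ∀ m, ∑' j, f j * ENNReal.ofReal (peelTransition m j) ≤ K * f m) (t : ℕ) :
    ∫⁻ ω, f (M (t + 1) ω) ∂P ≤ K * ∫⁻ ω, f (M t ω) ∂P := by
  obtain ⟨hmeas, hch⟩ := hM
  let X : Ω → (Fin (t + 1) → ℕ) := fun ω i => M i ω
  have hX : Measurable X := measurable_pi_lambda _ fun i => hmeas i
  have hXM : Measurable (fun ω => (X ω, M (t + 1) ω)) := hX.prodMk (hmeas _)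
  have key : ∀ (x : Fin (t + 1) → ℕ) (j : ℕ), P ((fun ω => (X ω, M (t + 1) ω)) ⁻¹' {(x, j)}) =
      P (X ⁻¹' {x}) * ENNReal.ofReal (peelTransition (x (Fin.last t)) j) := by
    intro x j
    let h : ℕ → ℕ := fun i => if hi : i < t + 1 then x ⟨i, hi⟩ else 0
    have hs : {ω | ∀ i ≤ t, M i ω = h i} = X ⁻¹' {x} := by
      ext ω
      simp only [Set.mem_ofPred_eq, Set.mem_preimage, Set.mem_singleton_iff, funext_iff, X, h]
      constructor
      · intro H i
        have hH := H i (by omega)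
        rwa [dif_pos i.isLt] at hH
      · intro H i hi
        rw [dif_pos (by omega)]
        exact H ⟨i, by omega⟩
    have hmX : MeasurableSet (X ⁻¹' {x}) := hX (measurableSet_singleton x)
    have hpre : (fun ω => (X ω, M (t + 1) ω)) ⁻¹' {(x, j)} =
        X ⁻¹' {x} ∩ {ω | M (t + 1) ω = j} := by
      ext ω; simp
    rw [hpre]
    by_cases hz : P (X ⁻¹' {x}) = 0
    · rw [hz, zero_mul]
      exact measure_mono_null Set.inter_subset_left hz
    · have := hch t h (by rwa [hs]) j
      rw [hs, cond_apply hmX] at this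
      have hl : h t = x (Fin.last t) := by simp [h, Fin.last]
      rw [← hl, ← this, ← mul_assoc, ENNReal.mul_inv_cancel hz (measure_ne_top _ _), one_mul]
  have e1 : ∫⁻ ω, f (M (t + 1) ω) ∂P =
      ∑' x, P (X ⁻¹' {x}) *
        ∑' j, f j * ENNReal.ofReal (peelTransition (x (Fin.last t)) j) := by
    have : ∫⁻ ω, f (M (t + 1) ω) ∂P =
        ∫⁻ z, f z.2 ∂(P.map (fun ω => (X ω, M (t + 1) ω))) := by
      rw [lintegral_map (measurable_of_countable _) hXM]
    rw [this, lintegral_countable', ENNReal.tsum_prod']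
    refine tsum_congr fun x => ?_
    rw [← ENNReal.tsum_mul_left]
    refine tsum_congr fun j => ?_
    rw [Measure.map_apply hXM (measurableSet_singleton _), key]
    ring
  have e2 : ∫⁻ ω, f (M t ω) ∂P = ∑' x, P (X ⁻¹' {x}) * f (x (Fin.last t)) := by
    have : ∫⁻ ω, f (M t ω) ∂P = ∫⁻ z, f (z (Fin.last t)) ∂(P.map X) := by
      rw [lintegral_map (measurable_of_countable _) hX]
      simp [X]
    rw [this, lintegral_countable']
    refine tsum_congr fun x => ?_
    rw [Measure.map_apply hX (measurableSet_singleton _), mul_comm]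
  rw [e1, e2, ← ENNReal.tsum_mul_left]
  refine ENNReal.tsum_le_tsum fun x => ?_
  calc _ ≤ P (X ⁻¹' {x}) * (K * f (x (Fin.last t))) := by gcongr; exact hf _
    _ = _ := by ring

lemma iter_bound {Ω : Type*} [MeasurableSpace Ω] (P : Measure Ω)
    [IsProbabilityMeasure P] (M : ℕ → Ω → ℕ) (hM : IsPeelingChain P M) (m₀ : ℕ)
    (h0 : ∀ᵐ ω ∂P, M 0 ω = m₀)
    (f : ℕ → ENNReal) (K : ENNReal)
    (hf : ∀ m, ∑' j, f j * ENNReal.ofReal (peelTransition m j) ≤ K * f m) (t : ℕ) :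
    ∫⁻ ω, f (M t ω) ∂P ≤ K ^ t * f m₀ := by
  induction t with
  | zero =>
    have : ∫⁻ ω, f (M 0 ω) ∂P = ∫⁻ ω, f m₀ ∂P :=
      lintegral_congr_ae (h0.mono fun ω h => by simp [h])
    simp [this]
  | succ t ih =>
    calc _ ≤ _ := step_bound P M hM f K hf t
      _ ≤ K * (K ^ t * f m₀) := by gcongr
      _ = _ := by ring

lemma K_pow_le {n : ℕ} (hn : 1 ≤ n) {L y : ℝ} (hL : L = (n : ℝ) ^ ((2 : ℝ) / 3))
    (hy : y = Real.exp (-(1 / L))) :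
    (1 + 2 / 3 * (1 - y) ^ (3 / 2 : ℝ) / y) ^ n ≤ Real.exp 2 := by
  have hn' : (1 : ℝ) ≤ n := by exact_mod_cast hn
  have hL1 : 1 ≤ L := by rw [hL]; exact Real.one_le_rpow hn' (by norm_num)
  have hlam : 1 / L ≤ 1 := by rw [div_le_one (by linarith)]; exact hL1
  have hlam0 : 0 < 1 / L := by positivity
  have hy0 : 0 < y := by rw [hy]; positivity
  have hy1 : y < 1 := by rw [hy, Real.exp_lt_one_iff]; linarith
  have h1 : 1 - y ≤ 1 / L := by
    have := Real.add_one_le_exp (-(1 / L))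
    rw [← hy] at this; linarith
  have h2 : (1 - y) ^ (3 / 2 : ℝ) ≤ 1 / n := by
    calc _ ≤ (1 / L) ^ (3 / 2 : ℝ) := by
          apply Real.rpow_le_rpow <;> linarith
      _ = 1 / n := by
          rw [Real.div_rpow zero_le_one (by linarith), Real.one_rpow, hL,
            ← Real.rpow_mul (by linarith)]
          norm_num
  have h3 : 1 / y ≤ 3 := by
    rw [hy, Real.exp_neg, one_div, inv_inv]
    have := Real.exp_le_exp.2 hlam
    linarith [Real.exp_one_lt_d9]
  have h4 : 2 / 3 * (1 - y) ^ (3 / 2 : ℝ) / y ≤ 2 / n := by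
    calc _ = 2 / 3 * (1 - y) ^ (3 / 2 : ℝ) * (1 / y) := by ring
      _ ≤ 2 / 3 * (1 / n) * 3 := by gcongr
      _ = _ := by ring
  have h5 : 0 ≤ (1 - y) ^ (3 / 2 : ℝ) := Real.rpow_nonneg (by linarith) _
  calc _ ≤ (Real.exp (2 / n)) ^ n := by
        gcongr
        linarith [Real.add_one_le_exp (2 / (n : ℝ))]
    _ = _ := by
        rw [← Real.exp_nat_mul]
        congr 1
        field_simp

lemma ff_lower {n : ℕ} (hn : 1 ≤ n) {L y : ℝ} (hL : L = (n : ℝ) ^ ((2 : ℝ) / 3))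
    (hy : y = Real.exp (-(1 / L))) (m : ℕ) (hm : 6 * (L * Real.log n) ≤ m) :
    (n : ℝ) ^ 2 / 5 ≤ ff y m := by
  have hn' : (1 : ℝ) ≤ n := by exact_mod_cast hn
  have hL1 : 1 ≤ L := by rw [hL]; exact Real.one_le_rpow hn' (by norm_num)
  have hLn : L ≤ n := by
    rw [hL]
    conv_rhs => rw [← Real.rpow_one (n : ℝ)]
    exact Real.rpow_le_rpow_of_exponent_le hn' (by norm_num)
  have hh0 := hh_pos m
  set E := Real.exp (m / (2 * L)) with hE
  have e1 : y⁻¹ ^ m = E * E := by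
    rw [hy, ← Real.exp_neg, neg_neg, ← Real.exp_nat_mul, hE, ← Real.exp_add]
    congr 1
    field_simp
    ring
  have h1 : (m : ℝ) / (2 * L) + 1 ≤ E := Real.add_one_le_exp _
  have h1' : (1 : ℝ) ≤ E := by
    have : 0 ≤ (m : ℝ) / (2 * L) := by positivity
    linarith
  have h2 : hh m ≤ 5 * n * E := by
    calc hh m ≤ 2 * m + 1 := hh_le m
      _ = 4 * L * (m / (2 * L)) + 1 := by field_simp; ring
      _ ≤ 4 * L * E + L * E := by
          have : 1 ≤ L * E := one_le_mul_of_one_le_of_one_le hL1 h1'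
          have : 4 * L * (m / (2 * L)) ≤ 4 * L * E := by gcongr; linarith
          linarith
      _ = 5 * L * E := by ring
      _ ≤ _ := by gcongr
  have h3 : (n : ℝ) ^ 3 ≤ E := by
    have : (n : ℝ) ^ 3 = Real.exp (3 * Real.log n) := by
      rw [show (3 : ℝ) = ((3 : ℕ) : ℝ) by norm_num, Real.exp_nat_mul,
        Real.exp_log (by linarith)]
    rw [this, hE]
    apply Real.exp_le_exp.2
    rw [le_div_iff₀ (by positivity)]
    linarith
  rw [ff, e1, div_le_div_iff₀ (by norm_num) hh0]
  calc (n : ℝ) ^ 2 * hh m ≤ (n : ℝ) ^ 2 * (5 * n * E) := by gcongr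
    _ = (n : ℝ) ^ 3 * E * 5 := by ring
    _ ≤ _ := by gcongr

lemma tail_bound {Ω : Type*} [MeasurableSpace Ω] (P : Measure Ω)
    [IsProbabilityMeasure P] (M : ℕ → Ω → ℕ) (hM : IsPeelingChain P M) (m₀ : ℕ)
    (h0 : ∀ᵐ ω ∂P, M 0 ω = m₀) {n : ℕ} (hn : 1 ≤ n) :
    P {ω | 6 * ((n : ℝ) ^ ((2 : ℝ) / 3) * Real.log n) ≤ M n ω} ≤
      ENNReal.ofReal (5 * Real.exp 2 * (Real.exp m₀ / hh m₀) * (1 / (n : ℝ) ^ 2)) := by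
  have hn' : (1 : ℝ) ≤ n := by exact_mod_cast hn
  obtain ⟨L, hL⟩ : ∃ L, L = (n : ℝ) ^ ((2 : ℝ) / 3) := ⟨_, rfl⟩
  obtain ⟨y, hy⟩ : ∃ y, y = Real.exp (-(1 / L)) := ⟨_, rfl⟩
  have hL1 : 1 ≤ L := by rw [hL]; exact Real.one_le_rpow hn' (by norm_num)
  have hlam : 1 / L ≤ 1 := by rw [div_le_one (by linarith)]; exact hL1
  have hlam0 : 0 < 1 / L := by positivity
  have hy0 : 0 < y := by rw [hy]; positivity
  have hy1 : y < 1 := by rw [hy, Real.exp_lt_one_iff]; linarith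
  have hh0 := hh_pos m₀
  have hff : ff y m₀ ≤ Real.exp m₀ / hh m₀ := by
    unfold ff
    gcongr
    rw [hy, ← Real.exp_neg, neg_neg, ← Real.exp_nat_mul]
    apply Real.exp_le_exp.2
    have : (0 : ℝ) ≤ m₀ := Nat.cast_nonneg _
    nlinarith
  have hI := iter_bound P M hM m₀ h0 (fun j => ENNReal.ofReal (ff y j)) _ (drift_enn hy0 hy1) n
  have hK0 : 0 ≤ 1 + 2 / 3 * (1 - y) ^ (3 / 2 : ℝ) / y := by
    have : 0 ≤ (1 - y) ^ (3 / 2 : ℝ) := Real.rpow_nonneg (by linarith) _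
    positivity
  have hI2 : ∫⁻ ω, ENNReal.ofReal (ff y (M n ω)) ∂P ≤
      ENNReal.ofReal (Real.exp 2 * (Real.exp m₀ / hh m₀)) := by
    refine hI.trans ?_
    rw [← ENNReal.ofReal_pow hK0, ← ENNReal.ofReal_mul (by positivity)]
    apply ENNReal.ofReal_le_ofReal
    have := K_pow_le hn hL hy
    have : 0 ≤ ff y m₀ := by unfold ff; positivity
    gcongr
  have hpos : 0 < (n : ℝ) ^ 2 / 5 := by positivity
  rw [← hL]
  calc _ ≤ P {ω | ENNReal.ofReal ((n : ℝ) ^ 2 / 5) ≤ ENNReal.ofReal (ff y (M n ω))} := by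
        apply measure_mono
        intro ω hω
        exact ENNReal.ofReal_le_ofReal (ff_lower hn hL hy _ hω)
    _ ≤ (∫⁻ ω, ENNReal.ofReal (ff y (M n ω)) ∂P) / ENNReal.ofReal ((n : ℝ) ^ 2 / 5) := by
        apply meas_ge_le_lintegral_div _ (by simpa using hpos) ENNReal.ofReal_ne_top
        exact ((measurable_of_countable (fun j => ENNReal.ofReal (ff y j))).comp
          (hM.1 n)).aemeasurable
    _ ≤ ENNReal.ofReal (Real.exp 2 * (Real.exp m₀ / hh m₀)) /
          ENNReal.ofReal ((n : ℝ) ^ 2 / 5) := by gcongr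
    _ = _ := by
        rw [← ENNReal.ofReal_div_of_pos hpos]
        congr 1
        field_simp

/-- Almost surely `limsup_{n→∞} M_n / (n^{2/3} log n) < ∞` for a peeling Markov
chain started from any fixed state `m₀`. -/
theorem peeling_chain_upper_bound {Ω : Type*} [MeasurableSpace Ω] (P : Measure Ω)
    [IsProbabilityMeasure P] (M : ℕ → Ω → ℕ) (hM : IsPeelingChain P M) (m₀ : ℕ)
    (h0 : ∀ᵐ ω ∂P, M 0 ω = m₀) :
    ∀ᵐ ω ∂P, IsBoundedUnder (· ≤ ·) atTop
      (fun n : ℕ => (M n ω : ℝ) / ((n : ℝ) ^ ((2 : ℝ) / 3) * Real.log n)) := by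
  have hs : ∑' n : ℕ, P {ω | 1 ≤ n ∧ 6 * ((n : ℝ) ^ ((2 : ℝ) / 3) * Real.log n) ≤ M n ω} ≠ ⊤ := by
    have hsum : Summable fun n : ℕ =>
        5 * Real.exp 2 * (Real.exp m₀ / hh m₀) * (1 / (n : ℝ) ^ 2) :=
      (Real.summable_one_div_nat_pow.2 (by norm_num)).mul_left _
    refine ne_top_of_le_ne_top hsum.tsum_ofReal_ne_top (ENNReal.tsum_le_tsum fun n => ?_)
    by_cases hn : 1 ≤ n
    · simpa only [hn, true_and] using tail_bound P M hM m₀ h0 hn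
    · simp [hn]
  filter_upwards [ae_eventually_notMem hs] with ω hω
  refine ⟨6, ?_⟩
  rw [eventually_map]
  filter_upwards [hω, eventually_ge_atTop 2] with n hn h2
  have h2' : (2 : ℝ) ≤ n := by exact_mod_cast h2
  have : 0 < Real.log n := Real.log_pos (by linarith)
  have h3 : 0 < (n : ℝ) ^ ((2 : ℝ) / 3) * Real.log n := by positivity
  rw [div_le_iff₀ h3]
  simp only [not_and, not_le] at hn
  exact (hn (by omega)).le
end

section
/- Let (M_t)_{t≥0} be a peeling Markov chain started from any fixed state m₀ ∈ ℕ, let X_t = M_{t+1} − M_t, and for γ > 3/2 let V_T(γ) = Σ_{t<T} |X_t|^γ. Then for every γ > 3/2 and every ε > 0, almost surely limsup_{T→∞} V_T(γ) / (T^{2γ/3} (log T)^{2γ/3+ε}) < ∞. -/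
open Filter MeasureTheory ProbabilityTheory

open Real

lemma aux_ratio (l : ℕ) : ∀ k : ℕ, ((2*l+1).factorial : ℝ) / (l.factorial : ℝ)^2 * 4^k ≤
    ((2*(l+k)+1).factorial : ℝ) / ((l+k).factorial : ℝ)^2 := by
  intro k
  induction k with
  | zero => simp
  | succ k ih =>
    have h1 : ((2*(l+(k+1))+1).factorial : ℝ) = (2*(l+k)+3) * ((2*(l+k)+2) * ((2*(l+k)+1).factorial : ℝ)) := by
      rw [show 2*(l+(k+1))+1 = (2*(l+k)+1)+1+1 by ring, Nat.factorial_succ, Nat.factorial_succ]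
      push_cast; ring
    have h2 : ((l+(k+1)).factorial : ℝ) = (l+k+1) * ((l+k).factorial : ℝ) := by
      rw [show l+(k+1) = (l+k)+1 by ring, Nat.factorial_succ]
      push_cast; ring
    rw [h1, h2, pow_succ (4:ℝ) k, ← mul_assoc (_ / _) ((4:ℝ)^k)]
    have hp : (0:ℝ) < ((l+k).factorial : ℝ) := by positivity
    have hq : (0:ℝ) < ((2*(l+k)+1).factorial : ℝ) := by positivity
    refine (mul_le_mul_of_nonneg_right ih (by norm_num : (0:ℝ) ≤ 4)).trans ?_
    rw [div_mul_eq_mul_div, div_le_div_iff₀ (by positivity) (by positivity)]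
    have : (4:ℝ) * (l+k+1)^2 ≤ (2*(l+k)+3)*(2*(l+k)+2) := by nlinarith [(Nat.cast_nonneg l : (0:ℝ) ≤ l), (Nat.cast_nonneg k : (0:ℝ) ≤ k)]
    have := mul_le_mul_of_nonneg_left this (by positivity : 0 ≤ ((2*(l+k)+1).factorial : ℝ) * ((l+k).factorial : ℝ)^2)
    linarith

lemma aux_central (n : ℕ) : ((Nat.centralBinom n : ℕ) : ℝ)^2 * (2*n+1) ≤ (4^n)^2 := by
  induction n with
  | zero => simp
  | succ n ih =>
    have h : ((n:ℝ)+1) * (Nat.centralBinom (n+1) : ℝ) = 2*(2*n+1) * (Nat.centralBinom n : ℝ) := by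
      exact_mod_cast Nat.succ_mul_centralBinom_succ n
    have hn : (0:ℝ) ≤ n := Nat.cast_nonneg n
    have h' : (Nat.centralBinom (n+1) : ℝ) = 2*(2*n+1) * (Nat.centralBinom n : ℝ) / (n+1) := by
      field_simp; linarith
    rw [h', div_pow, div_mul_eq_mul_div, div_le_iff₀ (by positivity)]
    push_cast
    have h3 : ((2:ℝ)*n+1)*(2*(n+1)+1) ≤ 4*(n+1)^2 := by nlinarith
    calc (2*(2*(n:ℝ)+1) * (Nat.centralBinom n : ℝ))^2 * (2*((n:ℝ)+1)+1)
        = ((Nat.centralBinom n : ℝ)^2 * (2*(n:ℝ)+1)) * (4 * ((2*(n:ℝ)+1)*(2*((n:ℝ)+1)+1))) := by ring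
      _ ≤ ((4:ℝ)^n)^2 * (4 * (4*((n:ℝ)+1)^2)) := by gcongr
      _ = _ := by ring

lemma pStep_nonneg (k m : ℕ) : 0 ≤ pStep k m := by
  unfold pStep; positivity

lemma pStep_le (k m : ℕ) (hk : 1 ≤ k) (hkm : k ≤ m) : pStep k m ≤ (k:ℝ) ^ (-(5/2) : ℝ) := by
  obtain ⟨n, rfl⟩ : ∃ n, k = n+1 := ⟨k-1, by omega⟩
  obtain ⟨l, rfl⟩ : ∃ l, m = l + (n+1) := ⟨m-(n+1), by omega⟩
  have hcb : (Nat.centralBinom n : ℝ) * ((n.factorial:ℝ) * n.factorial) = ((2*n).factorial : ℝ) := by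
    have := Nat.choose_mul_factorial_mul_factorial (n := 2*n) (k := n) (by omega)
    rw [show 2*n-n = n by omega] at this
    rw [Nat.centralBinom_eq_two_mul_choose, ← mul_assoc]
    exact_mod_cast this
  have hr := aux_ratio l (n+1)
  have hc := aux_central n
  have heq : pStep (n+1) (l+(n+1)) = 2 * (Nat.centralBinom n : ℝ) / ((n+1)*(n+2)) *
      ((((2*l+1).factorial : ℝ) / (l.factorial : ℝ)^2) / (((2*(l+(n+1))+1).factorial : ℝ) / ((l+(n+1)).factorial : ℝ)^2)) := by
    unfold pStep
    rw [show 2*(n+1)-2 = 2*n by omega, show 2*(l+(n+1))-2*(n+1)+1 = 2*l+1 by omega,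
      show n+1-1 = n by omega, show l+(n+1)-(n+1) = l by omega, ← hcb,
      Nat.factorial_succ (n+1), Nat.factorial_succ n]
    have h1 := (Nat.cast_pos (α := ℝ)).2 (Nat.factorial_pos n)
    have h2 := (Nat.cast_pos (α := ℝ)).2 (Nat.factorial_pos l)
    have h3 := (Nat.cast_pos (α := ℝ)).2 (Nat.factorial_pos (l+(n+1)))
    have h4 := (Nat.cast_pos (α := ℝ)).2 (Nat.factorial_pos (2*(l+(n+1))+1))
    push_cast
    generalize (n.factorial : ℝ) = a at *
    field_simp
    ring
  have hn : (0:ℝ) ≤ n := Nat.cast_nonneg n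
  have hR : ((((2*l+1).factorial : ℝ) / (l.factorial : ℝ)^2) / (((2*(l+(n+1))+1).factorial : ℝ) / ((l+(n+1)).factorial : ℝ)^2)) ≤ 1/4^(n+1) := by
    rw [div_le_div_iff₀ (by positivity) (by positivity)]
    linarith
  have hs : (Nat.centralBinom n : ℝ) * √((n:ℝ)+1) ≤ 4^n := by
    apply le_of_sq_le_sq _ (by positivity) 
    rw [mul_pow, Real.sq_sqrt (by positivity)]
    refine le_trans ?_ hc
    gcongr
    linarith
  have hpow : ((n+1:ℕ):ℝ) ^ (-(5/2):ℝ) = 1/((n+1)^2 * √((n:ℝ)+1)) := by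
    rw [Real.rpow_neg (by positivity), show (5/2:ℝ) = (2:ℕ) + 1/2 by norm_num, Real.rpow_add (by positivity),
      Real.rpow_natCast, ← Real.sqrt_eq_rpow]
    push_cast; rw [one_div]
  have hsp : 0 < √((n:ℝ)+1) := by positivity
  rw [heq, hpow]
  calc _ ≤ 2 * (4^n/√((n:ℝ)+1)) / ((n+1)*(n+1)) * (1/4^(n+1)) := by
        gcongr
        · rwa [le_div_iff₀ hsp]
        · norm_num
    _ = (1/2) * (1/((n+1)^2 * √((n:ℝ)+1))) := by
        field_simp; ring
    _ ≤ _ := by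
        have : 0 ≤ (1/((n+1)^2 * √((n:ℝ)+1))) := by positivity
        linarith

lemma pMinusOne_le (m : ℕ) : pMinusOne m ≤ 1 := by
  unfold pMinusOne
  rw [div_le_one (by positivity)]
  linarith [(Nat.cast_nonneg m : (0:ℝ) ≤ m)]

lemma up_le (m k : ℕ) (hk : 1 ≤ k) : peelTransition m (m+k) ≤ (k:ℝ) ^ (-(5/2) : ℝ) := by
  unfold peelTransition
  by_cases h : k = 1
  · subst h; simpa using pMinusOne_le m
  · rw [if_neg (by omega), if_neg (by omega)]; positivity

lemma down_le (m k : ℕ) (hk : 1 ≤ k) (hkm : k ≤ m) : peelTransition m (m-k) ≤ (k:ℝ) ^ (-(5/2) : ℝ) := by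
  unfold peelTransition
  rw [if_neg (by omega), if_pos (by omega), show m-(m-k) = k by omega]
  exact pStep_le k m hk hkm

lemma marg {Ω : Type*} [MeasurableSpace Ω] (P : Measure Ω)
    [IsProbabilityMeasure P] (M : ℕ → Ω → ℕ) (hM : IsPeelingChain P M) (t k : ℕ) (hk : 1 ≤ k) :
    P {ω | ((M (t+1) ω : ℤ) - M t ω).natAbs = k} ≤ 2 * ENNReal.ofReal ((k:ℝ) ^ (-(5/2) : ℝ)) := by
  obtain ⟨hmeas, hch⟩ := hM
  let H : (Fin (t+1) → ℕ) → Set Ω := fun f => {ω | ∀ i : Fin (t+1), M i ω = f i}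
  have hHm : ∀ f, MeasurableSet (H f) := by
    intro f
    have : H f = ⋂ i : Fin (t+1), M i ⁻¹' {f i} := by ext; simp [H]
    rw [this]
    exact MeasurableSet.iInter fun i => hmeas _ (measurableSet_singleton _)
  have hdisj : Pairwise (Function.onFun Disjoint H) := by
    intro f g hfg
    rw [Function.onFun, Set.disjoint_left]
    intro ω h1 h2
    exact hfg (funext fun i => (h1 i).symm.trans (h2 i))
  have hsum : ∑' f, P (H f) ≤ 1 := by
    rw [← measure_iUnion hdisj hHm]; exact prob_le_one
  set A := {ω | ((M (t+1) ω : ℤ) - M t ω).natAbs = k}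
  set q := 2 * ENNReal.ofReal ((k:ℝ) ^ (-(5/2) : ℝ))
  have key : ∀ f, P (H f ∩ A) ≤ P (H f) * q := by
    intro f
    by_cases h0 : P (H f) = 0
    · rw [h0, zero_mul]; exact (measure_mono Set.inter_subset_left).trans h0.le
    let h : ℕ → ℕ := fun i => if hi : i < t+1 then f ⟨i, hi⟩ else 0
    have hHe : {ω | ∀ i ≤ t, M i ω = h i} = H f := by
      ext ω
      simp only [H, Set.mem_ofPred_eq, h]
      constructor
      · intro hh i
        have := hh i (by omega)
        rw [dif_pos i.2] at this; exact this
      · intro hh i hi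
        rw [dif_pos (by omega)]
        exact hh ⟨i, by omega⟩
    have hc := hch t h (by rwa [hHe])
    rw [hHe] at hc
    have hj : ∀ j, P (H f ∩ {ω | M (t+1) ω = j}) = P (H f) * ENNReal.ofReal (peelTransition (h t) j) := by
      intro j
      rw [← hc j, cond_apply (hHm f), ← mul_assoc, ENNReal.mul_inv_cancel h0 (measure_ne_top _ _), one_mul]
    have hup : P (H f ∩ {ω | M (t+1) ω = h t + k}) ≤ P (H f) * ENNReal.ofReal ((k:ℝ) ^ (-(5/2) : ℝ)) := by
      rw [hj]; gcongr; exact up_le _ _ hk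
    have hMt : ∀ ω ∈ H f, M t ω = h t := by
      intro ω hω; rw [← hHe] at hω; exact hω t le_rfl
    rw [show P (H f) * q = P (H f) * ENNReal.ofReal ((k:ℝ) ^ (-(5/2) : ℝ)) + P (H f) * ENNReal.ofReal ((k:ℝ) ^ (-(5/2) : ℝ)) by
      simp only [q]; ring]
    by_cases hkt : k ≤ h t
    · have hdn : P (H f ∩ {ω | M (t+1) ω = h t - k}) ≤ P (H f) * ENNReal.ofReal ((k:ℝ) ^ (-(5/2) : ℝ)) := by
        rw [hj]; gcongr; exact down_le _ _ hk hkt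
      refine le_trans (measure_mono ?_) ((measure_union_le _ _).trans (add_le_add hup hdn))
      rintro ω ⟨h1, h2⟩
      have h3 := hMt ω h1
      simp only [A, Set.mem_ofPred_eq] at h2
      rcases le_total (M t ω) (M (t+1) ω) with h4 | h4
      · left; refine ⟨h1, ?_⟩; simp only [Set.mem_ofPred_eq]; omega
      · right; refine ⟨h1, ?_⟩; simp only [Set.mem_ofPred_eq]; omega
    · refine le_trans (measure_mono ?_) (hup.trans le_self_add)
      rintro ω ⟨h1, h2⟩
      have h3 := hMt ω h1
      simp only [A, Set.mem_ofPred_eq] at h2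
      refine ⟨h1, ?_⟩; simp only [Set.mem_ofPred_eq]; omega
  calc P A ≤ P (⋃ f, H f ∩ A) := by
        apply measure_mono
        intro ω hω
        exact Set.mem_iUnion.2 ⟨fun i => M i ω, fun i => rfl, hω⟩
    _ ≤ ∑' f, P (H f ∩ A) := measure_iUnion_le _
    _ ≤ ∑' f, P (H f) * q := ENNReal.tsum_le_tsum key
    _ = (∑' f, P (H f)) * q := ENNReal.tsum_mul_right
    _ ≤ 1 * q := by gcongr
    _ = q := one_mul q

lemma pow_tele (s : ℝ) (hs : 0 < s) (hs1 : s ≤ 1) (k : ℕ) :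
    ((k:ℝ)+1) ^ (s-1) ≤ (((k:ℝ)+1)^s - (k:ℝ)^s)/s := by
  have hk : (0:ℝ) < (k:ℝ)+1 := by positivity
  have h := rpow_one_add_le_one_add_mul_self (s := -1/((k:ℝ)+1)) (by
    rw [le_div_iff₀ hk]; linarith [(Nat.cast_nonneg k : (0:ℝ) ≤ k)]) hs.le hs1
  have e : 1 + -1/((k:ℝ)+1) = k/((k:ℝ)+1) := by field_simp; ring
  rw [e, Real.div_rpow (by positivity) hk.le, div_le_iff₀ (by positivity)] at h
  rw [Real.rpow_sub_one hk.ne', le_div_iff₀ hs]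
  have : (1 + s * (-1/((k:ℝ)+1))) * ((k:ℝ)+1)^s = ((k:ℝ)+1)^s - ((k:ℝ)+1)^s/((k:ℝ)+1) * s := by ring
  linarith

lemma neg_tele (k : ℕ) :
    ((k:ℝ)+1) ^ (-(5/2):ℝ) ≤ 2 * ((k:ℝ)+1)^(-(3/2):ℝ) - 2 * ((k:ℝ)+1+1)^(-(3/2):ℝ) := by
  have hk : (0:ℝ) < (k:ℝ)+1 := by positivity
  set x := (k:ℝ)+1 with hx
  have hx1 : 1 ≤ x := by rw [hx]; linarith [(Nat.cast_nonneg k : (0:ℝ) ≤ k)]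
  have e1 : x ^ (-(5/2):ℝ) = x^(-(3/2):ℝ) * (1/x) := by
    rw [show (-(5/2):ℝ) = -(3/2) - 1 by norm_num, Real.rpow_sub_one hk.ne']; ring
  have e2 : (x+1)^(-(3/2):ℝ) = x^(-(3/2):ℝ) * (1+1/x)^(-(3/2):ℝ) := by
    rw [← Real.mul_rpow hk.le (by positivity)]; congr 1; field_simp
  have h3 : (1+1/x)^(-(3/2):ℝ) ≤ 1 - 1/x/2 := by
    have : (1+1/x)^(-(3/2):ℝ) ≤ (1+1/x)^(-1:ℝ) :=
      Real.rpow_le_rpow_of_exponent_le (by linarith [show 0 ≤ 1/x by positivity]) (by norm_num)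
    refine this.trans ?_
    rw [Real.rpow_neg_one]
    have hu : 0 < 1/x := by positivity
    have hu1 : 1/x ≤ 1 := by rw [div_le_one hk]; exact hx1
    rw [inv_le_iff_one_le_mul₀ (by positivity)]
    nlinarith
  rw [e1, e2]
  nlinarith [Real.rpow_nonneg hk.le (-(3/2):ℝ)]

lemma sum_bound (γ : ℝ) (h1 : 3/2 < γ) (h2 : γ ≤ 2) (B : ℝ) (hB : 1 ≤ B) (n : ℕ) :
    ∑ k ∈ Finset.range n, min 1 ((((k:ℝ)+1)/B)^γ) * ((k:ℝ)+1)^(-(5/2):ℝ) ≤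
      (1/(γ-3/2) + 2) * B^(-(3/2):ℝ) := by
  set s := γ - 3/2 with hs
  have hs0 : 0 < s := by rw [hs]; linarith
  have hB0 : 0 < B := by linarith
  set f : ℕ → ℝ := fun k => min 1 ((((k:ℝ)+1)/B)^γ) * ((k:ℝ)+1)^(-(5/2):ℝ)
  have hf0 : ∀ k, 0 ≤ f k := fun k => by
    simp only [f]; positivity
  have c1 : ∀ N : ℕ, ∑ k ∈ Finset.range N, f k ≤ (N:ℝ)^s/s * B^(-γ) := by
    intro N
    induction N with
    | zero => simp [Real.zero_rpow hs0.ne']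
    | succ N ih =>
      rw [Finset.sum_range_succ]
      have hN : (0:ℝ) < (N:ℝ)+1 := by positivity
      have : f N ≤ ((((N:ℝ)+1)^s - (N:ℝ)^s)/s) * B^(-γ) := by
        calc f N ≤ (((N:ℝ)+1)/B)^γ * ((N:ℝ)+1)^(-(5/2):ℝ) := by
              simp only [f]; gcongr; exact min_le_right _ _
          _ = ((N:ℝ)+1)^(s-1) * B^(-γ) := by
              rw [Real.div_rpow hN.le hB0.le, Real.rpow_neg hB0.le,
                show s - 1 = γ + -(5/2) by rw [hs]; ring, Real.rpow_add hN]
              ring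
          _ ≤ _ := by
              gcongr; exact pow_tele s hs0 (by rw [hs]; linarith) N
      push_cast
      calc _ ≤ _ := add_le_add ih this
        _ = _ := by ring
  have c2 : ∀ N j : ℕ, ∑ k ∈ Finset.range (N+j), f k ≤ ∑ k ∈ Finset.range N, f k
      + 2 * ((N:ℝ)+1)^(-(3/2):ℝ) - 2 * (((N+j:ℕ):ℝ)+1)^(-(3/2):ℝ) := by
    intro N j
    induction j with
    | zero => simp
    | succ j ih =>
      rw [← add_assoc, Finset.sum_range_succ]
      have : f (N+j) ≤ (((N+j:ℕ):ℝ)+1) ^ (-(5/2):ℝ) := by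
        simp only [f]
        exact mul_le_of_le_one_left (by positivity) (min_le_left _ _)
      have h3 := neg_tele (N+j)
      push_cast at *
      linarith
  set N := ⌊B⌋₊
  have hNB : (N:ℝ) ≤ B := Nat.floor_le hB0.le
  have hBN : B ≤ (N:ℝ)+1 := (Nat.lt_floor_add_one B).le
  calc _ ≤ ∑ k ∈ Finset.range (N+n), f k :=
        Finset.sum_le_sum_of_subset_of_nonneg (Finset.range_mono (by omega)) fun k _ _ => hf0 k
    _ ≤ (N:ℝ)^s/s * B^(-γ) + 2 * ((N:ℝ)+1)^(-(3/2):ℝ) := by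
        have := c2 N n
        have h4 := c1 N
        have : 0 ≤ (((N+n:ℕ):ℝ)+1)^(-(3/2):ℝ) := by positivity
        linarith
    _ ≤ B^s/s * B^(-γ) + 2 * B^(-(3/2):ℝ) := by
        have h5 : ((N:ℝ)+1)^(-(3/2):ℝ) ≤ B^(-(3/2):ℝ) :=
          Real.rpow_le_rpow_of_nonpos hB0 hBN (by norm_num)
        gcongr
    _ = _ := by
        have : B^(-(3/2):ℝ) = B^s * B^(-γ) := by
          rw [← Real.rpow_add hB0]; congr 1; rw [hs]; ring
        rw [this]; ring

lemma sum_bound' (γ : ℝ) (h1 : 3/2 < γ) : ∃ C : ℝ, 0 ≤ C ∧ ∀ (B : ℝ) (_ : 1 ≤ B) (n : ℕ),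
    ∑ k ∈ Finset.range n, min 1 ((((k:ℝ)+1)/B)^γ) * ((k:ℝ)+1)^(-(5/2):ℝ) ≤
      C * B^(-(3/2):ℝ) := by
  have hg : 3/2 < min γ 2 := lt_min h1 (by norm_num)
  refine ⟨1/(min γ 2-3/2) + 2, ?_, fun B hB n => ?_⟩
  · have : 0 < min γ 2 - 3/2 := by linarith
    positivity
  · refine le_trans (Finset.sum_le_sum fun k _ => ?_) (sum_bound (min γ 2) hg (min_le_right _ _) B hB n)
    have hx : 0 < ((k:ℝ)+1)/B := by positivity
    refine mul_le_mul_of_nonneg_right ?_ (by positivity)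
    by_cases h : ((k:ℝ)+1)/B ≤ 1
    · exact min_le_min le_rfl (Real.rpow_le_rpow_of_exponent_ge hx h (min_le_left _ _))
    · rw [min_eq_left (Real.one_le_rpow (le_of_not_ge h) (by linarith : 0 ≤ min γ 2))]
      exact min_le_left _ _

noncomputable def LL (δ : ℝ) (t : ℕ) : ℝ := ((t:ℝ)+3) * Real.log ((t:ℝ)+3) ^ (1+δ)

lemma log_ge (t : ℕ) : 1 ≤ Real.log ((t:ℝ)+3) := by
  rw [Real.le_log_iff_exp_le (by positivity)]
  linarith [Real.exp_one_lt_d9, (Nat.cast_nonneg t : (0:ℝ) ≤ t)]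

lemma LL_ge (δ : ℝ) (hδ : 0 < δ) (t : ℕ) : 1 ≤ LL δ t := by
  unfold LL
  have := Real.one_le_rpow (log_ge t) (by linarith : 0 ≤ 1+δ)
  nlinarith [(Nat.cast_nonneg t : (0:ℝ) ≤ t)]

lemma LL_mono (δ : ℝ) (hδ : 0 < δ) : Monotone (LL δ) := by
  intro m n h
  have h' : (m:ℝ) ≤ n := by exact_mod_cast h
  have := log_ge m
  unfold LL
  gcongr

lemma LL_summable (δ : ℝ) (hδ : 0 < δ) : Summable fun t => 1/LL δ t := by
  have hp : ∀ t, 0 < LL δ t := fun t => by linarith [LL_ge δ hδ t]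
  rw [← summable_condensed_iff_of_nonneg (fun t => by have := hp t; positivity)
    (fun m n _ h => one_div_le_one_div_of_le (hp m) (LL_mono δ hδ h))]
  have hs : Summable fun k : ℕ => (Real.log 2)^(-(1+δ)) * (1/(k:ℝ)^(1+δ)) :=
    (Real.summable_one_div_nat_rpow.2 (by linarith)).mul_left _
  rw [← summable_nat_add_iff 1] at hs ⊢
  refine Summable.of_nonneg_of_le (fun k => ?_) (fun k => ?_) hs
  · have := hp (2^(k+1)); positivity
  · have hl2 : 0 < Real.log 2 := Real.log_pos (by norm_num)
    have hL : (((k+1:ℕ):ℝ) * Real.log 2) ≤ Real.log (((2^(k+1):ℕ):ℝ)+3) := by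
      rw [← Real.log_pow]
      apply Real.log_le_log (by positivity)
      push_cast; linarith
    have h1 : (2:ℝ)^(k+1) * (((k+1:ℕ):ℝ) * Real.log 2)^(1+δ) ≤ LL δ (2^(k+1)) := by
      unfold LL
      gcongr
      push_cast; linarith
    have hq : (0:ℝ) < (((k+1:ℕ):ℝ) * Real.log 2)^(1+δ) := by positivity
    calc (2:ℝ)^(k+1) * (1/LL δ (2^(k+1))) ≤ (2:ℝ)^(k+1) * (1/((2:ℝ)^(k+1) * (((k+1:ℕ):ℝ) * Real.log 2)^(1+δ))) := by
          gcongr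
      _ = 1/(((k+1:ℕ):ℝ) * Real.log 2)^(1+δ) := by field_simp
      _ = _ := by
          rw [Real.mul_rpow (by positivity) hl2.le, Real.rpow_neg hl2.le]; field_simp

lemma expect_bound {Ω : Type*} [MeasurableSpace Ω] (P : Measure Ω)
    [IsProbabilityMeasure P] (M : ℕ → Ω → ℕ) (hM : IsPeelingChain P M)
    (γ : ℝ) (hγ : 3 / 2 < γ) (C : ℝ) (hC0 : 0 ≤ C) (B : ℝ) (hB : 1 ≤ B)
    (hC : ∀ n : ℕ, ∑ k ∈ Finset.range n, min 1 ((((k:ℝ)+1)/B)^γ) * ((k:ℝ)+1)^(-(5/2):ℝ) ≤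
      C * B^(-(3/2):ℝ)) (t : ℕ) :
    ∫⁻ ω, ENNReal.ofReal (min 1 (((((M (t+1) ω : ℤ) - M t ω).natAbs : ℝ)/B)^γ)) ∂P ≤
      2 * ENNReal.ofReal (C * B^(-(3/2):ℝ)) := by
  have hK : Measurable fun ω => ((M (t+1) ω : ℤ) - M t ω).natAbs := by
    have h1 := hM.1 (t+1)
    have h2 := hM.1 t
    exact (measurable_of_countable (fun p : ℕ × ℕ => ((p.1:ℤ) - p.2).natAbs)).comp (h1.prodMk h2)
  set g : ℕ → ENNReal := fun k => ENNReal.ofReal (min 1 (((k:ℝ)/B)^γ)) with hg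
  have hg0 : g 0 = 0 := by
    simp [hg, Real.zero_rpow (by linarith : γ ≠ 0)]
  calc _ = ∫⁻ k, g k ∂(P.map fun ω => ((M (t+1) ω : ℤ) - M t ω).natAbs) :=
        (lintegral_map (measurable_of_countable g) hK).symm
    _ = ∑' k, g k * P {ω | ((M (t+1) ω : ℤ) - M t ω).natAbs = k} := by
        rw [lintegral_countable']
        congr 1; ext k
        rw [Measure.map_apply hK (measurableSet_singleton k)]
        rfl
    _ ≤ _ := by
        apply ENNReal.tsum_le_of_sum_range_le
        intro n
        refine le_trans (Finset.sum_le_sum_of_subset (Finset.range_mono (Nat.le_succ n))) ?_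
        rw [Finset.sum_range_succ', hg0, zero_mul, add_zero]
        refine le_trans ?_ (mul_le_mul_right (ENNReal.ofReal_le_ofReal (hC n)) 2)
        rw [ENNReal.ofReal_sum_of_nonneg (fun k _ => by positivity), Finset.mul_sum]
        refine Finset.sum_le_sum fun k _ => ?_
        refine (mul_le_mul_right (marg P M hM t (k+1) (by omega)) _).trans ?_
        rw [ENNReal.ofReal_mul (by positivity)]
        simp only [hg]
        push_cast
        exact le_of_eq (by ring)

lemma LL_upper (δ a : ℝ) (hδ : 0 < δ) (ha : 0 < a) (T : ℕ) (hT : 3 ≤ T) :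
    LL δ T ^ a ≤ ((2:ℝ) * 2^(1+δ))^a * ((T:ℝ)^a * Real.log T ^ (a + a*δ)) := by
  have hT' : (3:ℝ) ≤ T := by exact_mod_cast hT
  have hl : 0 < Real.log T := Real.log_pos (by linarith)
  have h1 : Real.log ((T:ℝ)+3) ≤ 2 * Real.log T := by
    have : 2 * Real.log T = Real.log ((T:ℝ)^2) := by rw [Real.log_pow]; norm_num
    rw [this]
    apply Real.log_le_log (by positivity); nlinarith
  have h0 := log_ge T
  have h2 : LL δ T ≤ (2*T) * (2 * Real.log T)^(1+δ) := by
    unfold LL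
    gcongr
    linarith
  have hL := LL_ge δ hδ T
  calc LL δ T ^ a ≤ ((2*T) * (2 * Real.log T)^(1+δ))^a := by gcongr
    _ = (((2:ℝ) * 2^(1+δ)) * (T * Real.log T^(1+δ)))^a := by
        rw [Real.mul_rpow (by norm_num) hl.le]; congr 1; ring
    _ = _ := by
        rw [Real.mul_rpow (by positivity) (by positivity), Real.mul_rpow (x := (T:ℝ)) (by positivity) (by positivity),
          ← Real.rpow_mul hl.le]
        congr 4; ring

/-- For `γ > 3/2` and `ε > 0`, with `X_t = M_{t+1} - M_t` and
`V_T(γ) = Σ_{t<T} |X_t|^γ`, almost surely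
`limsup_{T→∞} V_T(γ) / (T^{2γ/3} (log T)^{2γ/3+ε}) < ∞`. -/
theorem peeling_chain_variation_upper_bound {Ω : Type*} [MeasurableSpace Ω] (P : Measure Ω)
    [IsProbabilityMeasure P] (M : ℕ → Ω → ℕ) (hM : IsPeelingChain P M) (m₀ : ℕ)
    (h0 : ∀ᵐ ω ∂P, M 0 ω = m₀) (γ : ℝ) (hγ : 3 / 2 < γ) (ε : ℝ) (hε : 0 < ε) :
    ∀ᵐ ω ∂P, IsBoundedUnder (· ≤ ·) atTop
      (fun T : ℕ =>
        (∑ t ∈ Finset.range T, |(M (t + 1) ω : ℝ) - (M t ω : ℝ)| ^ γ) /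
          ((T : ℝ) ^ (2 * γ / 3) * Real.log T ^ (2 * γ / 3 + ε))) := by
  have ha : 0 < 2 * γ / 3 := by linarith
  set a := 2 * γ / 3 with hadef
  obtain ⟨δ, hδ, hδε⟩ : ∃ δ, 0 < δ ∧ a * δ = ε := ⟨ε/a, by positivity, by field_simp⟩
  obtain ⟨C, hC0, hC⟩ := sum_bound' γ hγ
  set B : ℕ → ℝ := fun t => LL δ t ^ (2/3 : ℝ) with hBdef
  have hLL : ∀ t, 1 ≤ LL δ t := LL_ge δ hδ
  have hB : ∀ t, 1 ≤ B t := fun t => Real.one_le_rpow (hLL t) (by norm_num)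
  have hBmono : Monotone B := fun m n h =>
    Real.rpow_le_rpow (by linarith [hLL m]) (LL_mono δ hδ h) (by norm_num)
  have hB32 : ∀ t, B t ^ (-(3/2):ℝ) = 1 / LL δ t := fun t => by
    simp only [hBdef]
    rw [← Real.rpow_mul (by linarith [hLL t])]
    norm_num [Real.rpow_neg_one]
  have hBγ : ∀ t, B t ^ γ = LL δ t ^ a := fun t => by
    simp only [hBdef]
    rw [← Real.rpow_mul (by linarith [hLL t])]
    congr 1; rw [hadef]; ring
  set K : ℕ → Ω → ℕ := fun t ω => ((M (t+1) ω : ℤ) - M t ω).natAbs with hK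
  have hKm : ∀ t, Measurable (K t) := fun t =>
    (measurable_of_countable (fun p : ℕ × ℕ => ((p.1:ℤ) - p.2).natAbs)).comp
      ((hM.1 (t+1)).prodMk (hM.1 t))
  set Z : ℕ → Ω → ENNReal := fun t ω => ENNReal.ofReal (min 1 (((K t ω : ℝ)/B t)^γ)) with hZ
  have hZm : ∀ t, Measurable (Z t) := fun t =>
    (measurable_of_countable (fun k : ℕ => ENNReal.ofReal (min 1 (((k : ℝ)/B t)^γ)))).comp (hKm t)
  have hint : ∫⁻ ω, ∑' t, Z t ω ∂P ≠ ⊤ := by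
    rw [lintegral_tsum (fun t => (hZm t).aemeasurable)]
    have h1 : ∑' t, ∫⁻ ω, Z t ω ∂P ≤ ∑' t, 2 * ENNReal.ofReal (C * (1 / LL δ t)) := by
      refine ENNReal.tsum_le_tsum fun t => ?_
      rw [← hB32]
      exact expect_bound P M hM γ hγ C hC0 (B t) (hB t) (hC (B t) (hB t)) t
    refine ne_top_of_le_ne_top ?_ h1
    rw [ENNReal.tsum_mul_left]
    refine ENNReal.mul_ne_top (by norm_num) ?_
    exact ((LL_summable δ hδ).mul_left C).tsum_ofReal_ne_top
  filter_upwards [ae_lt_top (Measurable.tsum hZm) hint] with ω hω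
  have hs1 : Summable fun t => min 1 (((K t ω : ℝ)/B t)^γ) := by
    have := ENNReal.summable_toReal hω.ne
    refine this.congr fun t => ?_
    simp only [hZ]
    have := hB t
    rw [ENNReal.toReal_ofReal (by positivity)]
  have hs2 : Summable fun t => ((K t ω : ℝ)/B t)^γ := by
    refine (summable_congr_atTop ?_).1 hs1
    filter_upwards [hs1.tendsto_atTop_zero.eventually (gt_mem_nhds (zero_lt_one))] with t ht
    rcases min_lt_iff.1 ht with h | h
    · exact absurd h (lt_irrefl _)
    · exact min_eq_right h.le
  set S := ∑' t, ((K t ω : ℝ)/B t)^γ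
  have hnn : ∀ t, 0 ≤ ((K t ω : ℝ)/B t)^γ := fun t => by have := hB t; positivity
  refine ⟨S * ((2:ℝ) * 2^(1+δ))^a, ?_⟩
  rw [eventually_map]
  filter_upwards [eventually_ge_atTop 3] with T hT
  have hT' : (3:ℝ) ≤ T := by exact_mod_cast hT
  have hl : 0 < Real.log T := Real.log_pos (by linarith)
  have hS0 : 0 ≤ S := tsum_nonneg hnn
  rw [div_le_iff₀ (by positivity), mul_assoc, ← hδε]
  calc ∑ t ∈ Finset.range T, |(M (t + 1) ω : ℝ) - (M t ω : ℝ)| ^ γ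
      ≤ ∑ t ∈ Finset.range T, ((K t ω : ℝ)/B t)^γ * B T ^ γ := by
        refine Finset.sum_le_sum fun t ht => ?_
        have hBt := hB t
        have e : |(M (t + 1) ω : ℝ) - (M t ω : ℝ)| = (K t ω : ℝ) := by
          simp only [hK]
          rw [Nat.cast_natAbs]; push_cast; rfl
        have hm := hBmono (Finset.mem_range.1 ht).le
        rw [e, ← Real.mul_rpow (by positivity) (by linarith)]
        apply Real.rpow_le_rpow (by positivity) _ (by linarith)
        calc (K t ω : ℝ) = (K t ω : ℝ)/B t * B t := by field_simp
          _ ≤ _ := by gcongr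
    _ = (∑ t ∈ Finset.range T, ((K t ω : ℝ)/B t)^γ) * B T ^ γ := by rw [Finset.sum_mul]
    _ ≤ S * B T ^ γ := by
        have := hB T
        gcongr
        exact hs2.sum_le_tsum _ fun t _ => hnn t
    _ ≤ _ := by
        rw [hBγ]
        exact mul_le_mul_of_nonneg_left (LL_upper δ a hδ ha T hT) hS0
end
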